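/- arXiv:2206.09841 — 7 statements merged into one kernel-verified Lean document; each statement's English description precedes it below -/
import Mathlib

section
/- Let X be a real n×d matrix with no identically zero column, let y ∈ ℝⁿ, and suppose the set I₊ = {β ∈ ℝᵈ : β ≥ 0 componentwise and Xβ = y} is nonempty. Let h ∈ ℝᵈ be the diagonal of XᵀX (h_k = Σᵢ X_{ik}²) and let S₊ = {supp(β) : β ∈ I₊}, where supp(β) = {k : β_k > 0}. Then there is at most one set S ∈ S₊ such that either S = ∅, or the matrix X_Sᵀ X_S is invertible and the domination condition h_{Sᶜ} > X_{Sᶜ}ᵀ X_S (X_Sᵀ X_S)⁻¹ h_S holds componentwise in ℝ^{d−|S|}. -/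
open scoped BigOperators

/-- The Gram matrix `X_Sᵀ X_S` of the columns of `X` indexed by `S`. -/
noncomputable def colGram {n d : ℕ} (X : Matrix (Fin n) (Fin d) ℝ) (S : Finset (Fin d)) :
    Matrix {k // k ∈ S} {k // k ∈ S} ℝ :=
  Matrix.of fun k l => ∑ i, X i k.val * X i l.val

/-- The domination condition `h_{Sᶜ} > X_{Sᶜ}ᵀ X_S (X_Sᵀ X_S)⁻¹ h_S` (componentwise),
where `h` is the diagonal of `XᵀX`. -/
def DominationCond {n d : ℕ} (X : Matrix (Fin n) (Fin d) ℝ) (S : Finset (Fin d)) : Prop :=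
  ∀ k : Fin d, k ∉ S →
    (∑ l : {l // l ∈ S}, (∑ i, X i k * X i l.val) *
        (colGram X S)⁻¹.mulVec (fun l => ∑ i, (X i l.val) ^ 2) l) < ∑ i, (X i k) ^ 2

/-- If `S = ∅` or the domination condition holds for `S`, then there is a dual certificate: a
vector `z` with `(Xᵀz)_k = h_k` on `S` and `(Xᵀz)_k < h_k` off `S`. -/
theorem exists_dual_certificate {n d : ℕ} (X : Matrix (Fin n) (Fin d) ℝ)
    (hX : ∀ k, ∃ i, X i k ≠ 0) (S : Finset (Fin d))
    (hcond : S = ∅ ∨ (IsUnit (colGram X S).det ∧ DominationCond X S)) :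
    ∃ z : Fin n → ℝ, (∀ k ∈ S, Matrix.vecMul z X k = ∑ i, (X i k) ^ 2) ∧
      ∀ k ∉ S, Matrix.vecMul z X k < ∑ i, (X i k) ^ 2 := by
  rcases hcond with rfl | ⟨hdet, hdom⟩
  · refine ⟨0, by simp, fun k _ => ?_⟩
    obtain ⟨i, hi⟩ := hX k
    rw [Matrix.zero_vecMul]
    exact Finset.sum_pos' (fun j _ => sq_nonneg _) ⟨i, Finset.mem_univ i, by positivity⟩
  · set w := (colGram X S)⁻¹.mulVec (fun l => ∑ i, (X i l.val) ^ 2) with hw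
    have key : ∀ k, Matrix.vecMul (fun i => ∑ l : {l // l ∈ S}, X i l.val * w l) X k =
        ∑ l : {l // l ∈ S}, (∑ i, X i k * X i l.val) * w l := by
      intro k
      simp only [Matrix.vecMul, dotProduct, Finset.sum_mul]
      rw [Finset.sum_comm]
      refine Finset.sum_congr rfl fun l _ => Finset.sum_congr rfl fun i _ => by ring
    refine ⟨_, fun k hk => ?_, fun k hk => (key k).trans_lt (hdom k hk)⟩
    have hG : (colGram X S).mulVec w = fun l => ∑ i, (X i l.val) ^ 2 := by
      rw [hw, Matrix.mulVec_mulVec, Matrix.mul_nonsing_inv _ hdet, Matrix.one_mulVec]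
    exact (key k).trans (congrFun hG ⟨k, hk⟩)

/-- A strict dual certificate for the support of `β` forces `β` to minimize `γ ↦ ⟨h, γ⟩` among
nonnegative vectors with the same image, and every minimizer to be supported in `S`. -/
theorem sum_mul_le_of_dual_certificate {n d : ℕ} (X : Matrix (Fin n) (Fin d) ℝ)
    {h β γ : Fin d → ℝ} {S : Finset (Fin d)} {z : Fin n → ℝ}
    (heq : ∀ k ∈ S, Matrix.vecMul z X k = h k) (hlt : ∀ k ∉ S, Matrix.vecMul z X k < h k)
    (hβ : ∀ k ∉ S, β k = 0) (hγ : ∀ k, 0 ≤ γ k) (hXβγ : X.mulVec β = X.mulVec γ) :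
    ∑ k, h k * β k ≤ ∑ k, h k * γ k ∧
      (∑ k, h k * γ k ≤ ∑ k, h k * β k → ∀ k, 0 < γ k → k ∈ S) := by
  have hle : ∀ k, Matrix.vecMul z X k ≤ h k := fun k => by
    by_cases hk : k ∈ S
    · exact (heq k hk).le
    · exact (hlt k hk).le
  have hsum : ∑ k, h k * β k = ∑ k, Matrix.vecMul z X k * γ k := by
    have hdual : Matrix.vecMul z X ⬝ᵥ β = Matrix.vecMul z X ⬝ᵥ γ := by
      rw [← Matrix.dotProduct_mulVec, ← Matrix.dotProduct_mulVec, hXβγ]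
    refine Eq.trans (Finset.sum_congr rfl fun k _ => ?_) hdual
    by_cases hk : k ∈ S
    · rw [heq k hk]
    · simp [hβ k hk]
  have hterm : ∀ k ∈ Finset.univ, Matrix.vecMul z X k * γ k ≤ h k * γ k :=
    fun k _ => mul_le_mul_of_nonneg_right (hle k) (hγ k)
  refine ⟨hsum.trans_le (Finset.sum_le_sum hterm), fun hge k hk => ?_⟩
  by_contra hkS
  exact (Finset.sum_lt_sum hterm
    ⟨k, Finset.mem_univ k, mul_lt_mul_of_pos_right (hlt k hkS) hk⟩).not_ge (hge.trans_eq hsum)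

/-- If `X` has no identically zero column, there is at most one support `S` of a
nonnegative interpolator of the data `(X, y)` such that either `S = ∅`, or
`X_Sᵀ X_S` is invertible and the domination condition holds. -/
theorem dominating_support_unique {n d : ℕ} (X : Matrix (Fin n) (Fin d) ℝ)
    (y : Fin n → ℝ) (hX : ∀ k, ∃ i, X i k ≠ 0)
    (hI : ∃ β : Fin d → ℝ, (∀ k, 0 ≤ β k) ∧ X.mulVec β = y)
    (S₁ S₂ : Finset (Fin d))
    (hS₁ : ∃ β : Fin d → ℝ, (∀ k, 0 ≤ β k) ∧ X.mulVec β = y ∧ ∀ k, k ∈ S₁ ↔ 0 < β k)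
    (hS₂ : ∃ β : Fin d → ℝ, (∀ k, 0 ≤ β k) ∧ X.mulVec β = y ∧ ∀ k, k ∈ S₂ ↔ 0 < β k)
    (hcond₁ : S₁ = ∅ ∨ (IsUnit (colGram X S₁).det ∧ DominationCond X S₁))
    (hcond₂ : S₂ = ∅ ∨ (IsUnit (colGram X S₂).det ∧ DominationCond X S₂)) :
    S₁ = S₂ := by
  obtain ⟨β, hβ, hXβ, hβS⟩ := hS₁
  obtain ⟨γ, hγ, hXγ, hγS⟩ := hS₂
  obtain ⟨z₁, heq₁, hlt₁⟩ := exists_dual_certificate X hX S₁ hcond₁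
  obtain ⟨z₂, heq₂, hlt₂⟩ := exists_dual_certificate X hX S₂ hcond₂
  have hβ0 : ∀ k ∉ S₁, β k = 0 := fun k hk =>
    le_antisymm (not_lt.mp (mt (hβS k).mpr hk)) (hβ k)
  have hγ0 : ∀ k ∉ S₂, γ k = 0 := fun k hk =>
    le_antisymm (not_lt.mp (mt (hγS k).mpr hk)) (hγ k)
  obtain ⟨hle₁, hsub₁⟩ := sum_mul_le_of_dual_certificate X heq₁ hlt₁ hβ0 hγ (hXβ.trans hXγ.symm)
  obtain ⟨hle₂, hsub₂⟩ := sum_mul_le_of_dual_certificate X heq₂ hlt₂ hγ0 hβ (hXγ.trans hXβ.symm)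
  ext k
  exact ⟨fun hk => hsub₂ hle₁ k ((hβS k).mp hk), fun hk => hsub₁ hle₂ k ((hγS k).mp hk)⟩
end

section
/- Let X be a real n×d matrix, y ∈ ℝⁿ, h ∈ ℝᵈ the diagonal of XᵀX. Let S ⊆ {1,…,d} be nonempty such that X_Sᵀ X_S is invertible and h_{Sᶜ} > X_{Sᶜ}ᵀ X_S (X_Sᵀ X_S)⁻¹ h_S componentwise, and let β* ∈ ℝᵈ satisfy β* ≥ 0, Xβ* = y and supp(β*) = S. Let δ > 0 be such that β*_k > δ[(2X_Sᵀ X_S)⁻¹ h_S]_k for all k ∈ S. Then the pair β^S := [β*_S − δ(2X_Sᵀ X_S)⁻¹ h_S, 0_{Sᶜ}] and μ^S := [0_S, δ(h_{Sᶜ} − X_{Sᶜ}ᵀ X_S (X_Sᵀ X_S)⁻¹ h_S)] consists of nonnegative vectors satisfying 2Xᵀ(Xβ^S − y) + δh = μ^S and ⟨μ^S, β^S⟩ = 0; in particular β^S is a minimizer of L_δ(β) = ‖Xβ − y‖₂² + δ⟨h, β⟩ over the nonnegative orthant, with supp(β^S) = S and μ^S_{Sᶜ} > 0 componentwise. -/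
open scoped BigOperators

/-- The weighted Lasso objective `L_δ(β) = ‖Xβ - y‖₂² + δ⟨h, β⟩`, where
`h` is the diagonal of `XᵀX`. -/
noncomputable def weightedLasso {n d : ℕ} (X : Matrix (Fin n) (Fin d) ℝ)
    (y : Fin n → ℝ) (δ : ℝ) (β : Fin d → ℝ) : ℝ :=
  (∑ i, (X.mulVec β i - y i) ^ 2) + δ * ∑ k, (∑ i, (X i k) ^ 2) * β k

/-- The primal witness `β^S = [β*_S - δ(2X_SᵀX_S)⁻¹ h_S, 0_{Sᶜ}]`. -/
noncomputable def betaWitness {n d : ℕ} (X : Matrix (Fin n) (Fin d) ℝ)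
    (S : Finset (Fin d)) (δ : ℝ) (βstar : Fin d → ℝ) : Fin d → ℝ :=
  fun k =>
    if hk : k ∈ S then
      βstar k - δ * ((2 : ℝ) • colGram X S)⁻¹.mulVec
        (fun l => ∑ i, (X i l.val) ^ 2) ⟨k, hk⟩
    else 0

/-- The dual witness `μ^S = [0_S, δ(h_{Sᶜ} - X_{Sᶜ}ᵀ X_S (X_SᵀX_S)⁻¹ h_S)]`. -/
noncomputable def muWitness {n d : ℕ} (X : Matrix (Fin n) (Fin d) ℝ)
    (S : Finset (Fin d)) (δ : ℝ) : Fin d → ℝ :=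
  fun k =>
    if k ∈ S then 0
    else δ * ((∑ i, (X i k) ^ 2) -
      ∑ l : {l // l ∈ S}, (∑ i, X i k * X i l.val) *
        (colGram X S)⁻¹.mulVec (fun l => ∑ i, (X i l.val) ^ 2) l)

theorem weightedLasso_eq_add {n d : ℕ} (X : Matrix (Fin n) (Fin d) ℝ)
    (y : Fin n → ℝ) (δ : ℝ) (β β' : Fin d → ℝ) :
    weightedLasso X y δ β' = weightedLasso X y δ β +
      ∑ i, (X.mulVec β' i - X.mulVec β i) ^ 2 +
      ∑ k, (2 * (∑ i, X i k * (X.mulVec β i - y i)) + δ * ∑ i, (X i k) ^ 2) *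
        (β' k - β k) := by
  have key : ∑ k, (∑ i, X i k * (X.mulVec β i - y i)) * (β' k - β k) =
      ∑ i, (X.mulVec β i - y i) * (X.mulVec β' i - X.mulVec β i) := by
    simp_rw [Finset.sum_mul]
    rw [Finset.sum_comm]
    refine Finset.sum_congr rfl fun i _ => ?_
    have hdiff : X.mulVec β' i - X.mulVec β i = ∑ k, X i k * (β' k - β k) := by
      simp_rw [Matrix.mulVec, dotProduct, mul_sub, Finset.sum_sub_distrib]
    rw [hdiff, Finset.mul_sum]
    exact Finset.sum_congr rfl fun k _ => by ring
  have hsq : ∑ i, (X.mulVec β' i - y i) ^ 2 = ∑ i, (X.mulVec β i - y i) ^ 2 +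
      ∑ i, (X.mulVec β' i - X.mulVec β i) ^ 2 +
      2 * ∑ i, (X.mulVec β i - y i) * (X.mulVec β' i - X.mulVec β i) := by
    rw [Finset.mul_sum, ← Finset.sum_add_distrib, ← Finset.sum_add_distrib]
    exact Finset.sum_congr rfl fun i _ => by ring
  have hlin : ∑ k, (2 * (∑ i, X i k * (X.mulVec β i - y i)) + δ * ∑ i, (X i k) ^ 2) *
      (β' k - β k) = 2 * (∑ k, (∑ i, X i k * (X.mulVec β i - y i)) * (β' k - β k)) +
      (δ * (∑ k, (∑ i, (X i k) ^ 2) * β' k) - δ * ∑ k, (∑ i, (X i k) ^ 2) * β k) := by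
    simp only [Finset.mul_sum (Finset.univ : Finset (Fin d))]
    rw [← Finset.sum_sub_distrib, ← Finset.sum_add_distrib]
    exact Finset.sum_congr rfl fun k _ => by ring
  rw [hlin, key, weightedLasso, weightedLasso, hsq]
  ring

/-- The Karush-Kuhn-Tucker conditions are sufficient for optimality over the nonnegative
orthant. -/
theorem weightedLasso_le_of_kkt {n d : ℕ} {X : Matrix (Fin n) (Fin d) ℝ}
    {y : Fin n → ℝ} {δ : ℝ} {β μ β' : Fin d → ℝ} (hμ : ∀ k, 0 ≤ μ k)
    (hstat : ∀ k, 2 * (∑ i, X i k * (X.mulVec β i - y i)) + δ * ∑ i, (X i k) ^ 2 = μ k)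
    (hcomp : ∑ k, μ k * β k = 0) (hβ' : ∀ k, 0 ≤ β' k) :
    weightedLasso X y δ β ≤ weightedLasso X y δ β' := by
  rw [weightedLasso_eq_add X y δ β β']
  simp_rw [hstat, mul_sub]
  rw [Finset.sum_sub_distrib, hcomp]
  have h₁ : 0 ≤ ∑ i, (X.mulVec β' i - X.mulVec β i) ^ 2 :=
    Finset.sum_nonneg fun i _ => sq_nonneg _
  have h₂ : 0 ≤ ∑ k, μ k * β' k :=
    Finset.sum_nonneg fun k _ => mul_nonneg (hμ k) (hβ' k)
  linarith

theorem two_smul_colGram_inv_mulVec {n d : ℕ} {X : Matrix (Fin n) (Fin d) ℝ}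
    {S : Finset (Fin d)} (hinv : IsUnit (colGram X S).det) (v : {k // k ∈ S} → ℝ)
    (k : {k // k ∈ S}) :
    ((2 : ℝ) • colGram X S)⁻¹.mulVec v k = (colGram X S)⁻¹.mulVec v k / 2 := by
  have : Invertible (2 : ℝ) := invertibleOfNonzero two_ne_zero
  rw [Matrix.inv_smul _ _ hinv, Matrix.smul_mulVec, Pi.smul_apply, smul_eq_mul, invOf_eq_inv]
  ring

theorem mulVec_betaWitness {n d : ℕ} {X : Matrix (Fin n) (Fin d) ℝ}
    {S : Finset (Fin d)} (hinv : IsUnit (colGram X S).det) (δ : ℝ) {βstar : Fin d → ℝ}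
    (hzero : ∀ k, k ∉ S → βstar k = 0) (i : Fin n) :
    X.mulVec (betaWitness X S δ βstar) i = X.mulVec βstar i -
      δ / 2 * ∑ l : {l // l ∈ S}, X i l.val *
        (colGram X S)⁻¹.mulVec (fun l => ∑ i, (X i l.val) ^ 2) l := by
  have restrict (f : Fin d → ℝ) (hf : ∀ k, k ∉ S → f k = 0) :
      X.mulVec f i = ∑ l : {l // l ∈ S}, X i l.val * f l.val := by
    rw [Finset.sum_coe_sort S fun l => X i l * f l]
    exact (Finset.sum_subset (Finset.subset_univ S) fun k _ hk => by
      rw [hf k hk, mul_zero]).symm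
  rw [restrict _ hzero, restrict _ fun k hk => by simp [betaWitness, hk], Finset.mul_sum,
    ← Finset.sum_sub_distrib]
  refine Finset.sum_congr rfl fun l _ => ?_
  rw [betaWitness, dif_pos l.2, two_smul_colGram_inv_mulVec hinv]
  ring

/-- In the standard noise regime, the explicit primal-dual pair `(β^S, μ^S)` consists of
nonnegative vectors satisfying the KKT conditions for the weighted Lasso; in particular
`β^S` is a minimiser over the nonnegative orthant, with support `S` and `μ^S > 0`
outside `S`. -/
theorem betaWitness_muWitness_kkt {n d : ℕ} (X : Matrix (Fin n) (Fin d) ℝ)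
    (y : Fin n → ℝ) (S : Finset (Fin d)) (hS : S.Nonempty)
    (hinv : IsUnit (colGram X S).det)
    (hdom : ∀ k : Fin d, k ∉ S →
      (∑ l : {l // l ∈ S}, (∑ i, X i k * X i l.val) *
          (colGram X S)⁻¹.mulVec (fun l => ∑ i, (X i l.val) ^ 2) l) < ∑ i, (X i k) ^ 2)
    (βstar : Fin d → ℝ) (hβpos : ∀ k, 0 ≤ βstar k) (hinterp : X.mulVec βstar = y)
    (hsupp : ∀ k, k ∈ S ↔ 0 < βstar k)
    (δ : ℝ) (hδ : 0 < δ)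
    (hδsmall : ∀ k : {l // l ∈ S},
      δ * ((2 : ℝ) • colGram X S)⁻¹.mulVec (fun l => ∑ i, (X i l.val) ^ 2) k
        < βstar k.val) :
    (∀ k, 0 ≤ betaWitness X S δ βstar k) ∧
    (∀ k, 0 ≤ muWitness X S δ k) ∧
    (∀ k, 2 * (∑ i, X i k * (X.mulVec (betaWitness X S δ βstar) i - y i)) +
        δ * ∑ i, (X i k) ^ 2 = muWitness X S δ k) ∧
    (∑ k, muWitness X S δ k * betaWitness X S δ βstar k) = 0 ∧
    (∀ β' : Fin d → ℝ, (∀ k, 0 ≤ β' k) →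
        weightedLasso X y δ (betaWitness X S δ βstar) ≤ weightedLasso X y δ β') ∧
    (∀ k, k ∈ S ↔ 0 < betaWitness X S δ βstar k) ∧
    (∀ k, k ∉ S → 0 < muWitness X S δ k) := by
  have hzero : ∀ k, k ∉ S → βstar k = 0 := fun k hk =>
    le_antisymm (not_lt.mp fun h => hk ((hsupp k).mpr h)) (hβpos k)
  have hβS : ∀ k, k ∈ S → 0 < betaWitness X S δ βstar k := fun k hk => by
    rw [betaWitness, dif_pos hk]
    exact sub_pos.mpr (hδsmall ⟨k, hk⟩)
  have hβSc : ∀ k, k ∉ S → betaWitness X S δ βstar k = 0 := fun k hk => by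
    simp [betaWitness, hk]
  have hμS : ∀ k, k ∈ S → muWitness X S δ k = 0 := fun k hk => by simp [muWitness, hk]
  have hμSc : ∀ k, k ∉ S → 0 < muWitness X S δ k := fun k hk => by
    rw [muWitness, if_neg hk]
    exact mul_pos hδ (sub_pos.mpr (hdom k hk))
  have hμ : ∀ k, 0 ≤ muWitness X S δ k := fun k => by
    by_cases hk : k ∈ S
    exacts [(hμS k hk).ge, (hμSc k hk).le]
  have hcomp : ∑ k, muWitness X S δ k * betaWitness X S δ βstar k = 0 :=
    Finset.sum_eq_zero fun k _ => by
      by_cases hk : k ∈ S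
      · rw [hμS k hk, zero_mul]
      · rw [hβSc k hk, mul_zero]
  have hstat : ∀ k, 2 * (∑ i, X i k * (X.mulVec (betaWitness X S δ βstar) i - y i)) +
      δ * ∑ i, (X i k) ^ 2 = muWitness X S δ k := fun k => by
    have hgrad : 2 * (∑ i, X i k * (X.mulVec (betaWitness X S δ βstar) i - y i)) =
        -(δ * ∑ l : {l // l ∈ S}, (∑ i, X i k * X i l.val) *
          (colGram X S)⁻¹.mulVec (fun l => ∑ i, (X i l.val) ^ 2) l) := by
      simp_rw [mulVec_betaWitness hinv δ hzero, hinterp, sub_sub_cancel_left,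
        Finset.sum_mul]
      rw [Finset.sum_comm, Finset.mul_sum, Finset.mul_sum, ← Finset.sum_neg_distrib]
      refine Finset.sum_congr rfl fun i _ => ?_
      simp_rw [mul_assoc]
      rw [← Finset.mul_sum]
      ring
    rw [hgrad]
    by_cases hk : k ∈ S
    · have hsolve : (colGram X S).mulVec ((colGram X S)⁻¹.mulVec
          fun l => ∑ i, (X i l.val) ^ 2) ⟨k, hk⟩ = ∑ i, (X i k) ^ 2 := by
        rw [Matrix.mulVec_mulVec, Matrix.mul_nonsing_inv _ hinv, Matrix.one_mulVec]
      have hsum : (∑ l : {l // l ∈ S}, (∑ i, X i k * X i l.val) *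
          (colGram X S)⁻¹.mulVec (fun l => ∑ i, (X i l.val) ^ 2) l) =
            ∑ i, (X i k) ^ 2 := hsolve
      rw [hμS k hk, hsum, neg_add_cancel]
    · rw [muWitness, if_neg hk]
      ring
  refine ⟨fun k => ?_, hμ, hstat, hcomp,
    fun β' hβ' => weightedLasso_le_of_kkt hμ hstat hcomp hβ',
    fun k => ⟨hβS k, fun h => by_contra fun hk => h.ne' (hβSc k hk)⟩, hμSc⟩
  by_cases hk : k ∈ S
  exacts [(hβS k hk).le, (hβSc k hk).ge]
end

section
/- Let X be a real n×d matrix, y ∈ ℝⁿ, h ∈ ℝᵈ the diagonal of XᵀX, and let δ > 0 satisfy δ h_k > 2[Xᵀy]_k for every k ∈ {1,…,d}. Then the pair β = 0, μ = δh − 2Xᵀy is a pair of nonnegative vectors satisfying 2Xᵀ(Xβ − y) + δh = μ and ⟨μ, β⟩ = 0, and it is the unique such pair: if (β', μ') are nonnegative vectors with 2Xᵀ(Xβ' − y) + δh = μ' and ⟨μ', β'⟩ = 0, then β' = 0 and μ' = δh − 2Xᵀy. In particular, β = 0 is the unique minimizer of L_δ(β) = ‖Xβ − y‖₂² + δ⟨h,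 β⟩ over the nonnegative orthant. -/
open scoped BigOperators

/-- The dual witness `μ = δh - 2Xᵀy` of the large noise regime. -/
noncomputable def muLargeNoise {n d : ℕ} (X : Matrix (Fin n) (Fin d) ℝ)
    (y : Fin n → ℝ) (δ : ℝ) : Fin d → ℝ :=
  fun k => δ * (∑ i, (X i k) ^ 2) - 2 * ∑ i, X i k * y i

/-- The adjoint identity `⟨Xᵀv, β⟩ = ⟨v, Xβ⟩`. -/
theorem sum_transpose_mul_eq {n d : ℕ} (X : Matrix (Fin n) (Fin d) ℝ)
    (v : Fin n → ℝ) (β : Fin d → ℝ) :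
    ∑ k, (∑ i, X i k * v i) * β k = ∑ i, v i * X.mulVec β i := by
  simp only [Matrix.mulVec, dotProduct, Finset.sum_mul, Finset.mul_sum]
  rw [Finset.sum_comm]
  exact Finset.sum_congr rfl fun i _ => Finset.sum_congr rfl fun k _ => by ring

theorem sum_muLargeNoise_mul {n d : ℕ} (X : Matrix (Fin n) (Fin d) ℝ)
    (y : Fin n → ℝ) (δ : ℝ) (β : Fin d → ℝ) :
    ∑ k, muLargeNoise X y δ k * β k
      = δ * ∑ k, (∑ i, (X i k) ^ 2) * β k - 2 * ∑ i, y i * X.mulVec β i := by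
  rw [← sum_transpose_mul_eq, Finset.mul_sum, Finset.mul_sum, ← Finset.sum_sub_distrib]
  exact Finset.sum_congr rfl fun k _ => by simp only [muLargeNoise]; ring

theorem weightedLasso_eq {n d : ℕ} (X : Matrix (Fin n) (Fin d) ℝ)
    (y : Fin n → ℝ) (δ : ℝ) (β : Fin d → ℝ) :
    weightedLasso X y δ β = ∑ i, (X.mulVec β i) ^ 2 + ∑ k, muLargeNoise X y δ k * β k
      + ∑ i, (y i) ^ 2 := by
  have h : ∑ i, (X.mulVec β i - y i) ^ 2
      = ∑ i, (X.mulVec β i) ^ 2 - 2 * ∑ i, y i * X.mulVec β i + ∑ i, (y i) ^ 2 := by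
    rw [Finset.mul_sum, ← Finset.sum_sub_distrib, ← Finset.sum_add_distrib]
    exact Finset.sum_congr rfl fun i _ => by ring
  rw [weightedLasso, h, sum_muLargeNoise_mul]
  ring

theorem weightedLasso_gradient_eq {n d : ℕ} (X : Matrix (Fin n) (Fin d) ℝ)
    (y : Fin n → ℝ) (δ : ℝ) (β : Fin d → ℝ) (k : Fin d) :
    2 * (∑ i, X i k * (X.mulVec β i - y i)) + δ * ∑ i, (X i k) ^ 2
      = 2 * (∑ i, X i k * X.mulVec β i) + muLargeNoise X y δ k := by
  simp only [muLargeNoise, mul_sub, Finset.sum_sub_distrib]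
  ring

theorem eq_zero_of_sum_mul_nonpos {ι : Type*} [Fintype ι] {μ β : ι → ℝ}
    (hμ : ∀ k, 0 < μ k) (hβ : ∀ k, 0 ≤ β k) (h : ∑ k, μ k * β k ≤ 0) : β = 0 := by
  have hnonneg : ∀ k ∈ Finset.univ, 0 ≤ μ k * β k := fun k _ => mul_nonneg (hμ k).le (hβ k)
  have hzero := (Finset.sum_eq_zero_iff_of_nonneg hnonneg).1 (h.antisymm (Finset.sum_nonneg hnonneg))
  funext k
  exact (mul_eq_zero.1 (hzero k (Finset.mem_univ k))).resolve_left (hμ k).ne'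

/-- Large noise regime: if `δ h_k > 2[Xᵀy]_k` for every `k`, then `(0, δh - 2Xᵀy)` is the
unique nonnegative pair satisfying the KKT conditions `2Xᵀ(Xβ - y) + δh = μ`, `⟨μ, β⟩ = 0`;
in particular `β = 0` is the unique minimiser of the weighted Lasso over the nonnegative
orthant. -/
theorem large_noise_zero_unique {n d : ℕ} (X : Matrix (Fin n) (Fin d) ℝ)
    (y : Fin n → ℝ) (δ : ℝ) (hδ : 0 < δ)
    (hlarge : ∀ k, 2 * (∑ i, X i k * y i) < δ * ∑ i, (X i k) ^ 2) :
    (∀ k, 0 ≤ (0 : Fin d → ℝ) k) ∧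
    (∀ k, 0 ≤ muLargeNoise X y δ k) ∧
    (∀ k, 2 * (∑ i, X i k * (X.mulVec (0 : Fin d → ℝ) i - y i)) + δ * ∑ i, (X i k) ^ 2
        = muLargeNoise X y δ k) ∧
    (∑ k, muLargeNoise X y δ k * (0 : Fin d → ℝ) k) = 0 ∧
    (∀ β' μ' : Fin d → ℝ, (∀ k, 0 ≤ β' k) → (∀ k, 0 ≤ μ' k) →
      (∀ k, 2 * (∑ i, X i k * (X.mulVec β' i - y i)) + δ * ∑ i, (X i k) ^ 2 = μ' k) →
      (∑ k, μ' k * β' k) = 0 →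
      β' = 0 ∧ μ' = muLargeNoise X y δ) ∧
    (∀ β' : Fin d → ℝ, (∀ k, 0 ≤ β' k) →
        weightedLasso X y δ 0 ≤ weightedLasso X y δ β') ∧
    (∀ β : Fin d → ℝ, (∀ k, 0 ≤ β k) →
      (∀ β' : Fin d → ℝ, (∀ k, 0 ≤ β' k) →
        weightedLasso X y δ β ≤ weightedLasso X y δ β') → β = 0) := by
  have hpos : ∀ k, 0 < muLargeNoise X y δ k := fun k => sub_pos.2 (hlarge k)
  have hsq : ∀ β : Fin d → ℝ, 0 ≤ ∑ i, (X.mulVec β i) ^ 2 :=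
    fun β => Finset.sum_nonneg fun i _ => sq_nonneg _
  have hL0 : weightedLasso X y δ 0 = ∑ i, (y i) ^ 2 := by simp [weightedLasso]
  refine ⟨fun _ => le_rfl, fun k => (hpos k).le, fun k => ?_, by simp, ?_, ?_, ?_⟩
  · rw [weightedLasso_gradient_eq]
    simp
  · intro β μ hβ _ hkkt hcomp
    simp only [weightedLasso_gradient_eq] at hkkt
    have hβ0 : β = 0 := by
      refine eq_zero_of_sum_mul_nonpos hpos hβ ?_
      have hsum : ∑ k, μ k * β k
          = 2 * ∑ i, (X.mulVec β i) ^ 2 + ∑ k, muLargeNoise X y δ k * β k := by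
        simp only [← hkkt, add_mul, Finset.sum_add_distrib, mul_assoc, sq, ← Finset.mul_sum,
          sum_transpose_mul_eq]
      linarith [hsq β]
    refine ⟨hβ0, funext fun k => ?_⟩
    simp [← hkkt, hβ0]
  · intro β hβ
    rw [hL0, weightedLasso_eq]
    have : 0 ≤ ∑ k, muLargeNoise X y δ k * β k :=
      Finset.sum_nonneg fun k _ => mul_nonneg (hpos k).le (hβ k)
    linarith [hsq β]
  · intro β hβ hmin
    refine eq_zero_of_sum_mul_nonpos hpos hβ ?_
    have h := hmin 0 fun _ => le_rfl
    rw [hL0, weightedLasso_eq] at h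
    linarith [hsq β]
end

section
/- Let X be a real n×d matrix, u ∈ ℝᵈ, and c ∈ ℝᵈ with c_k > 0 for all k; set c_min = min_k c_k. Let w : [0,T) → ℝⁿ (with 0 < T ≤ ∞) be differentiable with w'(t) = −2 X exp(Xᵀ w(t) + u − ct) for all t ∈ [0,T), where exp acts componentwise on vectors of ℝᵈ. Then for every w̄ ∈ ℝⁿ and every t ∈ [0,T): ‖w(t) − w̄‖₂ ≤ ‖w(0) − w̄‖₂ + 2‖exp(Xᵀ w̄ + u)‖₂ · ‖X‖ / c_min, where ‖X‖ is the ℓ²-operator norm of X. -/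
open scoped BigOperators ENNReal

/-- The Euclidean (`ℓ²`) norm of a vector of `ℝ^m`. -/
noncomputable def euclNorm {m : ℕ} (v : Fin m → ℝ) : ℝ :=
  Real.sqrt (∑ i, (v i) ^ 2)

/-- The `ℓ²` operator norm of a matrix, i.e. the least `C ≥ 0` such that
`‖Xv‖₂ ≤ C ‖v‖₂` for all `v`. -/
noncomputable def l2OpNorm {n d : ℕ} (X : Matrix (Fin n) (Fin d) ℝ) : ℝ :=
  sInf {C : ℝ | 0 ≤ C ∧ ∀ v : Fin d → ℝ, euclNorm (X.mulVec v) ≤ C * euclNorm v}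

theorem euclNorm_nonneg {m : ℕ} (v : Fin m → ℝ) : 0 ≤ euclNorm v :=
  Real.sqrt_nonneg _

theorem euclNorm_sq {m : ℕ} (v : Fin m → ℝ) : euclNorm v ^ 2 = ∑ i, v i ^ 2 :=
  Real.sq_sqrt (Finset.sum_nonneg fun _ _ => sq_nonneg _)

theorem abs_sum_mul_le_euclNorm_mul {m : ℕ} (v w : Fin m → ℝ) :
    |∑ i, v i * w i| ≤ euclNorm v * euclNorm w := by
  refine abs_le_of_sq_le_sq ?_ (mul_nonneg (euclNorm_nonneg v) (euclNorm_nonneg w))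
  rw [mul_pow, euclNorm_sq, euclNorm_sq]
  exact Finset.sum_mul_sq_le_sq_mul_sq _ _ _

theorem euclNorm_mulVec_le_frobenius {n d : ℕ} (X : Matrix (Fin n) (Fin d) ℝ) (v : Fin d → ℝ) :
    euclNorm (X.mulVec v) ≤ Real.sqrt (∑ i, ∑ k, X i k ^ 2) * euclNorm v := by
  refine Real.sqrt_le_iff.2 ⟨mul_nonneg (Real.sqrt_nonneg _) (euclNorm_nonneg v), ?_⟩
  have hX : 0 ≤ ∑ i, ∑ k, X i k ^ 2 :=
    Finset.sum_nonneg fun _ _ => Finset.sum_nonneg fun _ _ => sq_nonneg _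
  rw [mul_pow, euclNorm_sq, Real.sq_sqrt hX, Finset.sum_mul]
  exact Finset.sum_le_sum fun i _ => Finset.sum_mul_sq_le_sq_mul_sq Finset.univ (X i) v

theorem l2OpNorm_nonneg {n d : ℕ} (X : Matrix (Fin n) (Fin d) ℝ) : 0 ≤ l2OpNorm X :=
  Real.sInf_nonneg fun _ h => h.1

theorem euclNorm_mulVec_le {n d : ℕ} (X : Matrix (Fin n) (Fin d) ℝ) (v : Fin d → ℝ) :
    euclNorm (X.mulVec v) ≤ l2OpNorm X * euclNorm v := by
  have hF := euclNorm_mulVec_le_frobenius X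
  rcases (euclNorm_nonneg v).eq_or_lt with h | h
  · have := hF v
    rw [← h, mul_zero] at this ⊢
    exact this
  · rw [← div_le_iff₀ h]
    refine le_csInf ⟨_, Real.sqrt_nonneg _, hF⟩ fun C hC => ?_
    rw [div_le_iff₀ h]
    exact hC.2 v

theorem euclNorm_exp_sub_mul_le {d : ℕ} {c : Fin d → ℝ} {m : ℝ} (hm : ∀ k, m ≤ c k)
    (a : Fin d → ℝ) {t : ℝ} (ht : 0 ≤ t) :
    euclNorm (fun k => Real.exp (a k - c k * t)) ≤
      Real.exp (-(m * t)) * euclNorm (fun k => Real.exp (a k)) := by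
  refine Real.sqrt_le_iff.2 ⟨mul_nonneg (Real.exp_pos _).le (euclNorm_nonneg _), ?_⟩
  rw [mul_pow, euclNorm_sq, Finset.mul_sum]
  refine Finset.sum_le_sum fun k _ => ?_
  rw [← mul_pow, ← Real.exp_add]
  refine pow_le_pow_left₀ (Real.exp_pos _).le (Real.exp_le_exp.2 ?_) 2
  linarith [mul_le_mul_of_nonneg_right (hm k) ht]

theorem sub_mul_exp_le_sub_mul_exp (a b : ℝ) :
    (a - b) * Real.exp b ≤ (a - b) * Real.exp a := by
  rcases le_total a b with h | h
  · exact mul_le_mul_of_nonpos_left (Real.exp_le_exp.2 h) (sub_nonpos.2 h)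
  · exact mul_le_mul_of_nonneg_left (Real.exp_le_exp.2 h) (sub_nonneg.2 h)

/-- Convexity of `v ↦ ‖exp(Xᵀ v + a)‖₁`, as monotonicity of its gradient. -/
theorem sum_mul_mulVec_exp_le {n d : ℕ} (X : Matrix (Fin n) (Fin d) ℝ) (a : Fin d → ℝ)
    (v z : Fin n → ℝ) :
    ∑ i, (v - z) i * X.mulVec (fun k => Real.exp ((∑ j, X j k * z j) + a k)) i ≤
      ∑ i, (v - z) i * X.mulVec (fun k => Real.exp ((∑ j, X j k * v j) + a k)) i := by
  have key : ∀ e : Fin d → ℝ, ∑ i, (v - z) i * X.mulVec e i =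
      ∑ k, ((∑ j, X j k * v j) - ∑ j, X j k * z j) * e k := by
    intro e
    simp only [Matrix.mulVec, dotProduct, Finset.mul_sum]
    rw [Finset.sum_comm]
    refine Finset.sum_congr rfl fun k _ => ?_
    rw [← Finset.sum_sub_distrib, Finset.sum_mul]
    refine Finset.sum_congr rfl fun i _ => ?_
    simp only [Pi.sub_apply]
    ring
  rw [key, key]
  refine Finset.sum_le_sum fun k _ => ?_
  have := sub_mul_exp_le_sub_mul_exp ((∑ j, X j k * v j) + a k) ((∑ j, X j k * z j) + a k)
  rwa [add_sub_add_right_eq_sub] at this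

/-- If `⟨v, v'⟩ ≤ K e^{-ms} ‖v‖` along a curve `v`, then its norm grows by at most `K / m`. -/
theorem euclNorm_le_add_div {n : ℕ} {v v' : ℝ → Fin n → ℝ} {K m t : ℝ} (hK : 0 ≤ K) (hm : 0 < m)
    (ht : 0 ≤ t) (hv : ∀ s ∈ Set.Icc 0 t, HasDerivAt v (v' s) s)
    (hb : ∀ s ∈ Set.Icc 0 t, ∑ i, v s i * v' s i ≤ K * Real.exp (-(m * s)) * euclNorm (v s)) :
    euclNorm (v t) ≤ euclNorm (v 0) + K / m := by
  refine le_of_forall_pos_le_add fun δ hδ => ?_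
  set f : ℝ → ℝ := fun s => ∑ i, v s i ^ 2 with hf
  have hf0 : ∀ s, 0 ≤ f s := fun s => Finset.sum_nonneg fun _ _ => sq_nonneg _
  have hpos : ∀ s, 0 < f s + δ ^ 2 := fun s => add_pos_of_nonneg_of_pos (hf0 s) (by positivity)
  set g : ℝ → ℝ := fun s => Real.sqrt (f s + δ ^ 2) + K / m * Real.exp (-(m * s)) with hg
  have hg' : ∀ s ∈ Set.Icc 0 t, HasDerivAt g ((2 * ∑ i, v s i * v' s i) /
      (2 * Real.sqrt (f s + δ ^ 2)) - K * Real.exp (-(m * s))) s := by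
    intro s hs
    have h1 : HasDerivAt f (2 * ∑ i, v s i * v' s i) s := by
      rw [Finset.mul_sum]
      refine HasDerivAt.fun_sum fun i _ => ?_
      refine ((hasDerivAt_pi.1 (hv s hs) i).fun_pow 2).congr_deriv ?_
      push_cast
      ring
    have h2 := (h1.add_const (δ ^ 2)).sqrt (hpos s).ne'
    have h3 : HasDerivAt (fun s : ℝ => -(m * s)) (-(m * 1)) s :=
      ((hasDerivAt_id s).const_mul m).neg
    refine (h2.add (h3.exp.const_mul (K / m))).congr_deriv ?_
    rw [sub_eq_add_neg]
    congr 1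
    field_simp
  have hanti : AntitoneOn g (Set.Icc 0 t) := by
    refine antitoneOn_of_hasDerivWithinAt_nonpos (convex_Icc 0 t)
      (fun s hs => (hg' s hs).continuousAt.continuousWithinAt)
      (fun s hs => (hg' s (interior_subset hs)).hasDerivWithinAt) fun s hs => ?_
    have hs' := interior_subset hs
    have hr : 0 < Real.sqrt (f s + δ ^ 2) := Real.sqrt_pos.2 (hpos s)
    have hle : euclNorm (v s) ≤ Real.sqrt (f s + δ ^ 2) :=
      Real.sqrt_le_sqrt (le_add_of_nonneg_right (sq_nonneg δ))
    rw [mul_div_mul_left _ _ two_ne_zero, sub_nonpos, div_le_iff₀ hr]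
    exact (hb s hs').trans (mul_le_mul_of_nonneg_left hle (by positivity))
  have hgt := hanti (Set.left_mem_Icc.2 ht) (Set.right_mem_Icc.2 ht) ht
  have h0 : Real.sqrt (f 0 + δ ^ 2) ≤ euclNorm (v 0) + δ := by
    refine Real.sqrt_le_iff.2 ⟨add_nonneg (euclNorm_nonneg _) hδ.le, ?_⟩
    have : f 0 = euclNorm (v 0) ^ 2 := (euclNorm_sq _).symm
    rw [this]
    nlinarith [mul_nonneg (euclNorm_nonneg (v 0)) hδ.le]
  have h1 : euclNorm (v t) ≤ Real.sqrt (f t + δ ^ 2) :=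
    Real.sqrt_le_sqrt (le_add_of_nonneg_right (sq_nonneg δ))
  have h2 : 0 ≤ K / m * Real.exp (-(m * t)) := by positivity
  simp only [hg, mul_zero, neg_zero, Real.exp_zero, mul_one] at hgt
  linarith

theorem pos_of_isGLB_range {d : ℕ} {c : Fin d → ℝ} (hc : ∀ k, 0 < c k) {m : ℝ}
    (hm : IsGLB (Set.range c) m) : 0 < m := by
  obtain ⟨k, hk⟩ := hm.nonempty.csInf_mem (Set.finite_range c)
  rw [hm.csInf_eq hm.nonempty] at hk
  exact hk ▸ hc k

/-- Bound on the gradient flow `w' = -2 X exp(Xᵀ w + u - ct)` in the large noise regime: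
for every `w̄` and every `t` in the domain,
`‖w(t) - w̄‖₂ ≤ ‖w(0) - w̄‖₂ + 2 ‖exp(Xᵀ w̄ + u)‖₂ ‖X‖ / c_min`. -/
theorem gradient_flow_bounded {n d : ℕ} (X : Matrix (Fin n) (Fin d) ℝ)
    (u c : Fin d → ℝ) (hc : ∀ k, 0 < c k)
    (cmin : ℝ) (hcmin : IsGLB (Set.range c) cmin)
    (T : ℝ≥0∞) (hT : 0 < T) (w : ℝ → Fin n → ℝ)
    (hw : ∀ t : ℝ, 0 ≤ t → ENNReal.ofReal t < T →
      HasDerivAt w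
        ((-2 : ℝ) • X.mulVec (fun k => Real.exp ((∑ i, X i k * w t i) + u k - c k * t))) t)
    (wbar : Fin n → ℝ) (t : ℝ) (ht0 : 0 ≤ t) (htT : ENNReal.ofReal t < T) :
    euclNorm (w t - wbar) ≤ euclNorm (w 0 - wbar) +
      2 * euclNorm (fun k => Real.exp ((∑ i, X i k * wbar i) + u k)) * l2OpNorm X / cmin := by
  have hm := pos_of_isGLB_range hc hcmin
  set B := euclNorm (fun k => Real.exp ((∑ i, X i k * wbar i) + u k)) with hB
  have hB0 : 0 ≤ B := euclNorm_nonneg _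
  have hX0 := l2OpNorm_nonneg X
  refine euclNorm_le_add_div (v := fun s => w s - wbar) (K := 2 * B * l2OpNorm X)
    (by positivity) hm ht0
    (fun s hs => (hw s hs.1 ((ENNReal.ofReal_le_ofReal hs.2).trans_lt htT)).sub_const wbar)
    fun s hs => ?_
  have hmono := sum_mul_mulVec_exp_le X (fun k => u k - c k * s) (w s) wbar
  simp only [← add_sub_assoc] at hmono
  have hcs := (abs_le.1 (abs_sum_mul_le_euclNorm_mul (w s - wbar)
    (X.mulVec fun k => Real.exp ((∑ j, X j k * wbar j) + u k - c k * s)))).1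
  have hexp := euclNorm_exp_sub_mul_le (fun k => hcmin.1 ⟨k, rfl⟩)
    (fun k => (∑ j, X j k * wbar j) + u k) hs.1
  have hbound := (euclNorm_mulVec_le X _).trans (mul_le_mul_of_nonneg_left hexp hX0)
  have hprod := mul_le_mul_of_nonneg_left hbound (euclNorm_nonneg (w s - wbar))
  rw [← hB] at hprod
  simp only [Pi.smul_apply, smul_eq_mul, mul_left_comm _ (-2 : ℝ), ← Finset.mul_sum]
  linarith
end

section
/- Let 0 ≤ μ' < μ and b ≥ 0, and let u : [t₁, t₂] → ℝ be a nonnegative differentiable function satisfying u'(t) ≤ −2μ'·u(t) + 2b·e^{−μt}·√(u(t)) for all t ∈ [t₁, t₂]. Then for all t ∈ [t₁, t₂]: √(u(t)) ≤ e^{−μ'(t−t₁)}·√(u(t₁)) + (b·e^{−μ't}/(μ−μ'))·(e^{−(μ−μ')t₁} − e^{−(μ−μ')t}). -/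
/-- Strict comparison principle for square roots: if `w > 0` starts above `√u` and
`u' < (w ^ 2)'` wherever `√u` meets `w`, then `√u ≤ w`. -/
theorem sqrt_le_of_deriv_lt_boundary {u u' w w' : ℝ → ℝ} {a b : ℝ}
    (hu : ∀ t ∈ Set.Icc a b, HasDerivAt u (u' t) t)
    (hw : ∀ t ∈ Set.Icc a b, HasDerivAt w (w' t) t)
    (hpos : ∀ t ∈ Set.Icc a b, 0 < w t)
    (ha : Real.sqrt (u a) ≤ w a)
    (bound : ∀ t ∈ Set.Icc a b, u t = w t ^ 2 → u' t < 2 * w t * w' t) :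
    ∀ t ∈ Set.Icc a b, Real.sqrt (u t) ≤ w t := by
  intro t ht
  have hab : a ∈ Set.Icc a b := ⟨le_rfl, ht.1.trans ht.2⟩
  have hw2 : ∀ s ∈ Set.Icc a b, HasDerivAt (fun s => w s ^ 2) (2 * w s * w' s) s := fun s hs => by
    simpa using (hw s hs).fun_pow 2
  refine (Real.sqrt_le_left (hpos t ht).le).2 ?_
  exact image_le_of_deriv_right_lt_deriv_boundary'
    (fun s hs => (hu s hs).continuousAt.continuousWithinAt)
    (fun s hs => (hu s (Set.Ico_subset_Icc_self hs)).hasDerivWithinAt)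
    ((Real.sqrt_le_left (hpos a hab).le).1 ha)
    (fun s hs => (hw2 s hs).continuousAt.continuousWithinAt)
    (fun s hs => (hw2 s (Set.Ico_subset_Icc_self hs)).hasDerivWithinAt)
    (fun s hs => bound s (Set.Ico_subset_Icc_self hs)) ht

/-- The perturbed supersolution: the solution of `w' = -ν w + b e^{-μ t} + ε e^{-ν (t - a)}`
with `w a = c + ε`. -/
theorem hasDerivAt_exp_supersolution {ν μ : ℝ} (hνμ : ν ≠ μ) (a b c ε t : ℝ) :
    HasDerivAt
      (fun t => Real.exp (-ν * (t - a)) * c +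
        b * Real.exp (-ν * t) / (μ - ν) *
          (Real.exp (-(μ - ν) * a) - Real.exp (-(μ - ν) * t)) +
        ε * (Real.exp (-ν * (t - a)) * (1 + (t - a))))
      (-ν * (Real.exp (-ν * (t - a)) * c +
        b * Real.exp (-ν * t) / (μ - ν) *
          (Real.exp (-(μ - ν) * a) - Real.exp (-(μ - ν) * t)) +
        ε * (Real.exp (-ν * (t - a)) * (1 + (t - a)))) +
        b * Real.exp (-μ * t) + ε * Real.exp (-ν * (t - a))) t := by
  have hsub : HasDerivAt (fun t : ℝ => t - a) 1 t := (hasDerivAt_id t).sub_const a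
  have h₁ := (hsub.const_mul (-ν)).exp
  have h₂ := ((hasDerivAt_id' t).const_mul (-ν)).exp
  have h₃ := ((hasDerivAt_id' t).const_mul (-(μ - ν))).exp
  have hne : μ - ν ≠ 0 := sub_ne_zero.2 hνμ.symm
  have hexp : Real.exp (-μ * t) = Real.exp (-ν * t) * Real.exp (-(μ - ν) * t) := by
    rw [← Real.exp_add]
    ring_nf
  refine (((h₁.mul_const c).fun_add (((h₂.const_mul b).div_const (μ - ν)).fun_mul
    (h₃.const_sub (Real.exp (-(μ - ν) * a))))).fun_add
    ((h₁.fun_mul (hsub.const_add 1)).const_mul ε)).congr_deriv ?_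
  rw [hexp]
  generalize Real.exp (-ν * t) = p, Real.exp (-(μ - ν) * t) = q,
    Real.exp (-(μ - ν) * a) = r, Real.exp (-ν * (t - a)) = s
  field_simp
  ring

/-- A Gronwall-type estimate: if `u ≥ 0` is differentiable on `[t₁, t₂]` with
`u'(t) ≤ -2μ' u(t) + 2b e^{-μt} √(u(t))`, where `0 ≤ μ' < μ` and `b ≥ 0`, then
`√(u(t)) ≤ e^{-μ'(t - t₁)} √(u(t₁)) + (b e^{-μ't}/(μ - μ'))(e^{-(μ-μ')t₁} - e^{-(μ-μ')t})`. -/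
theorem gronwall_sqrt_estimate (μ' μ b t₁ t₂ : ℝ) (hμ'0 : 0 ≤ μ') (hμ'μ : μ' < μ)
    (hb : 0 ≤ b) (ht : t₁ ≤ t₂) (u u' : ℝ → ℝ)
    (hderiv : ∀ t ∈ Set.Icc t₁ t₂, HasDerivAt u (u' t) t)
    (hpos : ∀ t ∈ Set.Icc t₁ t₂, 0 ≤ u t)
    (hineq : ∀ t ∈ Set.Icc t₁ t₂,
      u' t ≤ -2 * μ' * u t + 2 * b * Real.exp (-μ * t) * Real.sqrt (u t)) :
    ∀ t ∈ Set.Icc t₁ t₂,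
      Real.sqrt (u t) ≤ Real.exp (-μ' * (t - t₁)) * Real.sqrt (u t₁) +
        b * Real.exp (-μ' * t) / (μ - μ') *
          (Real.exp (-(μ - μ') * t₁) - Real.exp (-(μ - μ') * t)) := by
  intro t htt
  have hd : 0 < μ - μ' := sub_pos.2 hμ'μ
  have hE : 0 < Real.exp (-μ' * (t - t₁)) * (1 + (t - t₁)) :=
    mul_pos (Real.exp_pos _) (by linarith [htt.1])
  refine le_of_forall_pos_le_add fun δ hδ => ?_
  obtain ⟨ε, hε, hεδ⟩ : ∃ ε > 0, ε * (Real.exp (-μ' * (t - t₁)) * (1 + (t - t₁))) = δ :=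
    ⟨_, div_pos hδ hE, div_mul_cancel₀ _ hE.ne'⟩
  rw [← hεδ]
  have hw := hasDerivAt_exp_supersolution hμ'μ.ne t₁ b (Real.sqrt (u t₁)) ε
  have hwpos : ∀ s ∈ Set.Icc t₁ t₂, 0 < Real.exp (-μ' * (s - t₁)) * Real.sqrt (u t₁) +
      b * Real.exp (-μ' * s) / (μ - μ') *
        (Real.exp (-(μ - μ') * t₁) - Real.exp (-(μ - μ') * s)) +
      ε * (Real.exp (-μ' * (s - t₁)) * (1 + (s - t₁))) := fun s hs => by
    have h₁ : 0 < 1 + (s - t₁) := by linarith [hs.1]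
    have h₂ : 0 ≤ Real.exp (-(μ - μ') * t₁) - Real.exp (-(μ - μ') * s) :=
      sub_nonneg.2 (Real.exp_le_exp.2 (by nlinarith [hs.1]))
    positivity
  refine sqrt_le_of_deriv_lt_boundary hderiv (fun s _ => hw s) hwpos ?_ ?_ t htt
  · simpa using hε.le
  · intro s hs hus
    have hws := hwpos s hs
    have hle := hineq s hs
    rw [hus, Real.sqrt_sq hws.le] at hle
    refine hle.trans_lt ?_
    have := mul_pos hws (mul_pos hε (Real.exp_pos (-μ' * (s - t₁))))
    linarith
end

section
/- Let z₁,…,z_d ∈ ℝⁿ, Ω, ρ > 0 and a > 0 satisfy ‖z_k‖₂ ≤ Ω for all k and Σ_{k=1}^d ⟨z_k, u⟩² ≥ ρ‖u‖₂² for every u ∈ ℝⁿ, and let b₁,…,b_d be real numbers with b_k ≥ a for all k. Then for every r ∈ ℝⁿ: Σ_{k=1}^d b_k·(e^{⟨z_k, r⟩} − 1)·⟨z_k, r⟩ ≥ aρ·‖r‖₂²/(1 + Ω‖r‖₂). -/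
open scoped BigOperators RealInnerProductSpace

theorem sq_div_one_add_abs_le_exp_sub_one_mul (t : ℝ) :
    t ^ 2 / (1 + |t|) ≤ (Real.exp t - 1) * t := by
  rw [div_le_iff₀ (by positivity)]
  rcases le_total 0 t with ht | ht
  · rw [abs_of_nonneg ht]
    have h : t ≤ Real.exp t - 1 := by linarith [Real.add_one_le_exp t]
    nlinarith [mul_le_mul_of_nonneg_right h ht,
      mul_nonneg (mul_nonneg (ht.trans h) ht) ht]
  · rw [abs_of_nonpos ht]
    have h : Real.exp t * (1 - t) ≤ 1 := by
      calc Real.exp t * (1 - t) ≤ Real.exp t * Real.exp (-t) := by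
            gcongr
            linarith [Real.add_one_le_exp (-t)]
        _ = 1 := by rw [← Real.exp_add, add_neg_cancel, Real.exp_zero]
    nlinarith [mul_nonneg (sub_nonneg.2 h) (neg_nonneg.2 ht)]

/-- Strong convexity estimate on the support: if `‖z_k‖₂ ≤ Ω`, `∑ₖ ⟨z_k, u⟩² ≥ ρ‖u‖₂²`
and `b_k ≥ a > 0`, then `∑ₖ b_k (e^{⟨z_k, r⟩} - 1) ⟨z_k, r⟩ ≥ aρ‖r‖₂²/(1 + Ω‖r‖₂)`. -/
theorem sum_exp_margin_lower_bound {n d : ℕ} (z : Fin d → EuclideanSpace ℝ (Fin n))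
    (Ω ρ a : ℝ) (hΩ : 0 < Ω) (hρ : 0 < ρ) (ha : 0 < a)
    (hz : ∀ k, ‖z k‖ ≤ Ω)
    (hcoer : ∀ u : EuclideanSpace ℝ (Fin n), ρ * ‖u‖ ^ 2 ≤ ∑ k, ⟪z k, u⟫ ^ 2)
    (b : Fin d → ℝ) (hb : ∀ k, a ≤ b k)
    (r : EuclideanSpace ℝ (Fin n)) :
    a * ρ * ‖r‖ ^ 2 / (1 + Ω * ‖r‖) ≤
      ∑ k, b k * (Real.exp ⟪z k, r⟫ - 1) * ⟪z k, r⟫ := by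
  have hD : 0 < 1 + Ω * ‖r‖ := by positivity
  calc a * ρ * ‖r‖ ^ 2 / (1 + Ω * ‖r‖)
      = a / (1 + Ω * ‖r‖) * (ρ * ‖r‖ ^ 2) := by ring
    _ ≤ a / (1 + Ω * ‖r‖) * ∑ k, ⟪z k, r⟫ ^ 2 := by gcongr; exact hcoer r
    _ = ∑ k, a * (⟪z k, r⟫ ^ 2 / (1 + Ω * ‖r‖)) := by
        rw [Finset.mul_sum]
        exact Finset.sum_congr rfl fun k _ => by ring
    _ ≤ ∑ k, b k * (Real.exp ⟪z k, r⟫ - 1) * ⟪z k, r⟫ := by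
        refine Finset.sum_le_sum fun k _ => ?_
        have habs : |⟪z k, r⟫| ≤ Ω * ‖r‖ :=
          (abs_real_inner_le_norm _ _).trans (by gcongr; exact hz k)
        have hle : ⟪z k, r⟫ ^ 2 / (1 + Ω * ‖r‖) ≤ (Real.exp ⟪z k, r⟫ - 1) * ⟪z k, r⟫ :=
          le_trans (by gcongr) (sq_div_one_add_abs_le_exp_sub_one_mul _)
        rw [mul_assoc]
        exact mul_le_mul (hb k) hle (by positivity) (ha.le.trans (hb k))
end

section
/- Let n ≥ 1, a, ρ, Ω > 0 and δ > 0, let V : ℝⁿ → ℝ be V(r) = (2aρ/Ω²)(Ω‖r‖₂ − log(1+Ω‖r‖₂)), and define Z = ∫_{ℝⁿ} exp(−V(r)/(2δ)) dr (which is finite) and the probability measure μ on ℝⁿ with density Z⁻¹·exp(−V(r)/(2δ)) with respect to Lebesgue measure. Let σ² = ∫_{ℝⁿ} ‖r‖₂² dμ(r). Then μ satisfies a Poincaré inequality with constant at most 13σ²/n: for every continuously differentiable function f : ℝⁿ → ℝ such that f and ‖∇f‖₂ are square-integrable with respect to μ, ∫_{ℝⁿ} (f(r) − ∫ f dμ)²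 dμ(r) ≤ (13σ²/n)·∫_{ℝⁿ} ‖∇f(r)‖₂² dμ(r). -/
open MeasureTheory

theorem riccati_hardy_interval {g g' p p' Φ Φ' : ℝ → ℝ} {C a b : ℝ} (hC : 0 < C) (hab : a ≤ b)
    (hg : ∀ s, HasDerivAt g (g' s) s) (hg' : Continuous g')
    (hpc : ContinuousOn p (Set.Icc a b)) (hp : ∀ s ∈ Set.Ioo a b, HasDerivAt p (p' s) s)
    (hp0 : ∀ s ∈ Set.Ioo a b, 0 ≤ p s)
    (hΦc : ContinuousOn Φ (Set.Icc a b)) (hΦ : ∀ s ∈ Set.Ioo a b, HasDerivAt Φ (Φ' s) s)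
    (hric : ∀ s ∈ Set.Ioo a b, Φ' s * p s + Φ s * p' s + Φ s ^ 2 * p s / C ≤ -p s) :
    g b ^ 2 * Φ b * p b - g a ^ 2 * Φ a * p a + ∫ s in a..b, g s ^ 2 * p s
      ≤ C * ∫ s in a..b, g' s ^ 2 * p s := by
  have hgc : Continuous g := continuous_iff_continuousAt.2 fun s => (hg s).continuousAt
  have hu : Set.uIcc a b = Set.Icc a b := Set.uIcc_of_le hab
  have i1 : IntervalIntegrable (fun s => g s ^ 2 * p s) volume a b := by
    apply ContinuousOn.intervalIntegrable
    rw [hu]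
    exact (hgc.pow 2).continuousOn.mul hpc
  have i2 : IntervalIntegrable (fun s => g' s ^ 2 * p s) volume a b := by
    apply ContinuousOn.intervalIntegrable
    rw [hu]
    exact (hg'.pow 2).continuousOn.mul hpc
  have key := intervalIntegral.sub_le_integral_of_hasDeriv_right_of_le
    (g := fun s => g s ^ 2 * Φ s * p s)
    (g' := fun s => (2 * g s * g' s * Φ s + g s ^ 2 * Φ' s) * p s + g s ^ 2 * Φ s * p' s)
    (φ := fun s => C * (g' s ^ 2 * p s) - g s ^ 2 * p s) hab
    (((hgc.pow 2).continuousOn.mul hΦc).mul hpc)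
    (fun s hs => by
      refine HasDerivAt.hasDerivWithinAt ?_
      exact ((((hg s).pow 2).mul (hΦ s hs)).mul (hp s hs)).congr_deriv (by simp))
    (by
      rw [integrableOn_Icc_iff_integrableOn_Ioc,
        ← intervalIntegrable_iff_integrableOn_Ioc_of_le hab]
      exact (i2.const_mul C).sub i1)
    (fun s hs => by
      have h1 := mul_le_mul_of_nonneg_left (hric s hs) (sq_nonneg (g s))
      have h2 : 0 ≤ (C * g' s - g s * Φ s) ^ 2 / C * p s :=
        mul_nonneg (by positivity) (hp0 s hs)
      have h3 : (C * g' s - g s * Φ s) ^ 2 / C * p s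
          = C * (g' s ^ 2 * p s) - 2 * g s * g' s * Φ s * p s
            + g s ^ 2 * (Φ s ^ 2 * p s / C) := by
        field_simp
        ring
      linarith)
  rw [intervalIntegral.integral_sub (i2.const_mul C) i1, intervalIntegral.integral_const_mul] at key
  linarith

theorem hardy_of_logDeriv_le {g g' p p' : ℝ → ℝ} {ℓ T : ℝ} (hℓ : 0 < ℓ) (hT : ℓ ≤ T)
    (hg : ∀ s, HasDerivAt g (g' s) s) (hg' : Continuous g') (hg0 : g 0 = 0)
    (hpc : ContinuousOn p (Set.Icc 0 T)) (hp : ∀ s ∈ Set.Ioo 0 T, HasDerivAt p (p' s) s)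
    (hp0 : ∀ s ∈ Set.Icc 0 T, 0 ≤ p s)
    (hnear : ∀ s ∈ Set.Ioo 0 ℓ,
      p' s ≤ -((1 + 2 * (s / ℓ)) / 6 - 20 / 13 / (1 + 2 * (s / ℓ))) * (p s / ℓ))
    (hfar : ∀ s ∈ Set.Ioo ℓ T, p' s ≤ -(p s / ℓ)) :
    ∫ s in 0..T, g s ^ 2 * p s ≤ 13 * ℓ ^ 2 * ∫ s in 0..T, g' s ^ 2 * p s := by
  have hgc : Continuous g := continuous_iff_continuousAt.2 fun s => (hg s).continuousAt
  have hC : 0 < 13 * ℓ ^ 2 := by positivity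
  have e1 := riccati_hardy_interval (g := g) (p := p) (a := 0) (b := ℓ)
    (Φ := fun s => 6 * ℓ ^ 2 / (ℓ + 2 * s))
    (Φ' := fun s => -(12 * ℓ ^ 2 / (ℓ + 2 * s) ^ 2)) hC hℓ.le hg hg'
    (hpc.mono (Set.Icc_subset_Icc le_rfl hT))
    (fun s hs => hp s ⟨hs.1, hs.2.trans_le hT⟩) (fun s hs => hp0 s ⟨hs.1.le, hs.2.le.trans hT⟩)
    (by
      apply ContinuousOn.div (by fun_prop) (by fun_prop)
      intro s hs
      have := hs.1
      positivity)
    (fun s hs => by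
      have h0 := hs.1
      have h := ((hasDerivAt_id s).const_mul 2).const_add ℓ
      have := (hasDerivAt_const s (6 * ℓ ^ 2)).div h (by simp; positivity)
      exact this.congr_deriv (by simp; field_simp; ring))
    (fun s hs => by
      have h0 := hs.1
      have hps := hp0 s ⟨hs.1.le, hs.2.le.trans hT⟩
      have hΦ : 0 ≤ 6 * ℓ ^ 2 / (ℓ + 2 * s) := by positivity
      have h1 := mul_le_mul_of_nonneg_left (hnear s hs) hΦ
      have h2 : 6 * ℓ ^ 2 / (ℓ + 2 * s) *
          (-((1 + 2 * (s / ℓ)) / 6 - 20 / 13 / (1 + 2 * (s / ℓ))) * (p s / ℓ))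
          = -(-(12 * ℓ ^ 2 / (ℓ + 2 * s) ^ 2) * p s)
            - (6 * ℓ ^ 2 / (ℓ + 2 * s)) ^ 2 * p s / (13 * ℓ ^ 2) - p s := by
        field_simp
        ring
      linarith)
  have e2 := riccati_hardy_interval (g := g) (p := p) (a := ℓ) (b := T)
    (Φ := fun _ => 2 * ℓ) (Φ' := fun _ => 0) hC hT hg hg'
    (hpc.mono (Set.Icc_subset_Icc hℓ.le le_rfl))
    (fun s hs => hp s ⟨hℓ.trans hs.1, hs.2⟩) (fun s hs => hp0 s ⟨(hℓ.trans hs.1).le, hs.2.le⟩)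
    (by fun_prop) (fun s _ => hasDerivAt_const s _)
    (fun s hs => by
      have hps := hp0 s ⟨(hℓ.trans hs.1).le, hs.2.le⟩
      have h1 := mul_le_mul_of_nonneg_left (hfar s hs) (by positivity : 0 ≤ 2 * ℓ)
      have h2 : 2 * ℓ * -(p s / ℓ) = -2 * p s := by field_simp
      have h3 : (2 * ℓ) ^ 2 * p s / (13 * ℓ ^ 2) = 4 / 13 * p s := by field_simp; ring
      rw [h3]
      linarith)
  have ii : ∀ q : ℝ → ℝ, Continuous q → ∀ c d, c ∈ Set.Icc 0 T → d ∈ Set.Icc 0 T →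
      IntervalIntegrable (fun s => q s ^ 2 * p s) volume c d := by
    intro q hq c d hc hd
    apply ContinuousOn.intervalIntegrable
    exact (hq.pow 2).continuousOn.mul (hpc.mono (Set.uIcc_subset_Icc hc hd))
  have m0 : (0 : ℝ) ∈ Set.Icc 0 T := ⟨le_rfl, hℓ.le.trans hT⟩
  have m1 : ℓ ∈ Set.Icc 0 T := ⟨hℓ.le, hT⟩
  have m2 : T ∈ Set.Icc 0 T := ⟨hℓ.le.trans hT, le_rfl⟩
  rw [← intervalIntegral.integral_add_adjacent_intervals (ii g hgc _ _ m0 m1) (ii g hgc _ _ m1 m2),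
    ← intervalIntegral.integral_add_adjacent_intervals (ii g' hg' _ _ m0 m1)
      (ii g' hg' _ _ m1 m2), mul_add]
  have h5 : 6 * ℓ ^ 2 / (ℓ + 2 * ℓ) = 2 * ℓ := by field_simp; ring
  have h6 : 0 ≤ g T ^ 2 * (2 * ℓ) * p T := mul_nonneg (by positivity) (hp0 T m2)
  simp only [hg0, h5] at e1 e2
  linarith

theorem hardy_near_bound {N u : ℝ} (hN : 7 / 5 ≤ N) (hu0 : 0 < u) (hu1 : u < 1) :
    (1 - N * u) / (N - u) ≤ -((1 + 2 * u) / 6 - 20 / 13 / (1 + 2 * u)) := by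
  have h1 : (1 - N * u) / (N - u) ≤ (5 - 7 * u) / (7 - 5 * u) := by
    rw [div_le_div_iff₀ (by linarith) (by linarith)]
    nlinarith [mul_nonneg (sub_nonneg.2 hN) (by nlinarith : 0 ≤ 1 - u ^ 2)]
  refine h1.trans ?_
  have h2 : -((1 + 2 * u) / 6 - 20 / 13 / (1 + 2 * u))
      = (120 - 13 * (1 + 2 * u) ^ 2) / (78 * (1 + 2 * u)) := by
    field_simp
    ring
  rw [h2, div_le_div_iff₀ (by linarith) (by linarith)]
  nlinarith [sq_nonneg (1976 * u - 1133), pow_pos hu0 3]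

theorem continuousOn_radialDensity {w : ℝ → ℝ} (k : ℕ) (hwc : ContinuousOn w (Set.Ici 0)) :
    ContinuousOn (fun s => s ^ k * w s) (Set.Ici 0) :=
  (continuous_pow k).continuousOn.mul hwc

theorem hasDerivAt_radialDensity {w v : ℝ → ℝ} (k : ℕ) {s : ℝ} (hs : 0 < s)
    (hw : HasDerivAt w (-(v s * w s)) s) :
    HasDerivAt (fun s => s ^ k * w s) ((k / s - v s) * (s ^ k * w s)) s := by
  refine ((hasDerivAt_pow k s).mul hw).congr_deriv ?_
  rcases k with _ | k
  · simp
  · push_cast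
    field_simp
    ring

theorem radial_hardy_right {g g' w v : ℝ → ℝ} {n : ℕ} {s₀ T : ℝ} (hn : 2 ≤ n) (hs₀ : 0 < s₀)
    (hT : s₀ + s₀ / √n ≤ T)
    (hg : ∀ s, HasDerivAt g (g' s) s) (hg' : Continuous g')
    (hwc : ContinuousOn w (Set.Ici 0)) (hw0 : ∀ s, 0 ≤ s → 0 ≤ w s)
    (hw : ∀ s, 0 < s → HasDerivAt w (-(v s * w s)) s)
    (hv : ∀ s, s₀ ≤ s → n / s₀ ≤ v s) :
    ∫ s in s₀..T, (g s - g s₀) ^ 2 * (s ^ (n - 1) * w s)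
      ≤ 13 * s₀ ^ 2 / n * ∫ s in s₀..T, g' s ^ 2 * (s ^ (n - 1) * w s) := by
  have hn' : (2 : ℝ) ≤ n := by exact_mod_cast hn
  have hk : ((n - 1 : ℕ) : ℝ) = n - 1 := by rw [Nat.cast_sub (by omega)]; simp
  set N := √(n : ℝ) with hNdef
  have hN2 : N ^ 2 = n := Real.sq_sqrt (by linarith)
  have hN1 : 7 / 5 ≤ N := Real.le_sqrt_of_sq_le (by linarith)
  have hN0 : 0 < N := by linarith
  have hℓ : 0 < s₀ / N := by positivity
  have hderiv : ∀ s, 0 < s → HasDerivAt (fun s => (s ^ (n - 1) * w s))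
      (((n - 1) / s - v s) * (s ^ (n - 1) * w s)) s := fun s hs => by
    have := hasDerivAt_radialDensity (n - 1) hs (hw s hs)
    rwa [hk] at this
  have hp0 : ∀ s, 0 ≤ s → 0 ≤ s ^ (n - 1) * w s := fun s hs =>
    mul_nonneg (pow_nonneg hs _) (hw0 s hs)
  have key := hardy_of_logDeriv_le (g := fun t => g (s₀ + t) - g s₀) (g' := fun t => g' (s₀ + t))
    (p := fun t => (s₀ + t) ^ (n - 1) * w (s₀ + t))
    (p' := fun t => ((n - 1) / (s₀ + t) - v (s₀ + t)) * ((s₀ + t) ^ (n - 1) * w (s₀ + t)))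
    (ℓ := s₀ / N) (T := T - s₀) hℓ (by linarith)
    (fun s => ((hg (s₀ + s)).comp_const_add s₀ s).sub_const _) (by fun_prop) (by simp)
    (by
      refine (continuousOn_radialDensity (n - 1) hwc).comp (f := fun t => s₀ + t)
        (by fun_prop) fun t ht => ?_
      have := ht.1
      simp only [Set.mem_Ici]
      linarith)
    (fun s hs => by
      have := hs.1
      exact HasDerivAt.comp_const_add s₀ s (hderiv (s₀ + s) (by linarith)))
    (fun s hs => hp0 _ (by have := hs.1; linarith))
    (fun s hs => by
      have h0 := hs.1
      have h1 : s / (s₀ / N) < 1 := (div_lt_one hℓ).2 hs.2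
      have h2 : 0 < s / (s₀ / N) := by positivity
      have hp := hp0 (s₀ + s) (by linarith)
      have h3 : ((n : ℝ) - 1) / (s₀ + s) - v (s₀ + s) ≤ 0 := by
        have := hv (s₀ + s) (by linarith)
        have : ((n : ℝ) - 1) / (s₀ + s) ≤ n / s₀ := by gcongr <;> linarith
        linarith
      have h4 : 0 ≤ -((1 + 2 * (s / (s₀ / N))) / 6 - 20 / 13 / (1 + 2 * (s / (s₀ / N)))) := by
        rw [neg_nonneg, sub_nonpos, div_le_div_iff₀ (by norm_num) (by positivity),
          div_mul_eq_mul_div, le_div_iff₀ (by norm_num)]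
        nlinarith
      exact (mul_nonpos_of_nonpos_of_nonneg h3 hp).trans (mul_nonneg h4 (by positivity)))
    (fun s hs => by
      have h0 : 0 < s := hℓ.trans hs.1
      have hp := hp0 (s₀ + s) (by linarith)
      have h3 : ((n : ℝ) - 1) / (s₀ + s) - v (s₀ + s) ≤ -(N / s₀) := by
        have h4 := hv (s₀ + s) (by linarith)
        have h5 : ((n : ℝ) - 1) / (s₀ + s) ≤ (n - 1) / (s₀ + s₀ / N) := by
          have := hs.1
          gcongr
          linarith
        have h6 : ((n : ℝ) - 1) / (s₀ + s₀ / N) = n / s₀ - N / s₀ := by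
          rw [← hN2]
          field_simp
          ring
        linarith
      calc _ ≤ -(N / s₀) * ((s₀ + s) ^ (n - 1) * w (s₀ + s)) := mul_le_mul_of_nonneg_right h3 hp
        _ = _ := by field_simp)
  have c1 := intervalIntegral.integral_comp_add_left (a := 0) (b := T - s₀)
    (fun s => (g s - g s₀) ^ 2 * (s ^ (n - 1) * w s)) s₀
  have c2 := intervalIntegral.integral_comp_add_left (a := 0) (b := T - s₀)
    (fun s => g' s ^ 2 * (s ^ (n - 1) * w s)) s₀
  simp only [add_zero, add_sub_cancel] at c1 c2
  rw [← c1, ← c2]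
  convert key using 2
  rw [← hN2]
  field_simp

theorem radial_hardy_left {g g' w v : ℝ → ℝ} {n : ℕ} {s₀ : ℝ} (hn : 2 ≤ n) (hs₀ : 0 < s₀)
    (hg : ∀ s, HasDerivAt g (g' s) s) (hg' : Continuous g')
    (hwc : ContinuousOn w (Set.Ici 0)) (hw0 : ∀ s, 0 ≤ s → 0 ≤ w s)
    (hw : ∀ s, 0 < s → HasDerivAt w (-(v s * w s)) s)
    (hv : ∀ s, 0 < s → s ≤ s₀ → v s ≤ n / s₀) :
    ∫ s in 0..s₀, (g s - g s₀) ^ 2 * (s ^ (n - 1) * w s)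
      ≤ 13 * s₀ ^ 2 / n * ∫ s in 0..s₀, g' s ^ 2 * (s ^ (n - 1) * w s) := by
  have hn' : (2 : ℝ) ≤ n := by exact_mod_cast hn
  have hk : ((n - 1 : ℕ) : ℝ) = n - 1 := by rw [Nat.cast_sub (by omega)]; simp
  set N := √(n : ℝ) with hNdef
  have hN2 : N ^ 2 = n := Real.sq_sqrt (by linarith)
  have hN1 : 7 / 5 ≤ N := Real.le_sqrt_of_sq_le (by linarith)
  have hN0 : 0 < N := by linarith
  have hℓ : 0 < s₀ / N := by positivity
  have hℓ' : s₀ / N < s₀ := div_lt_self hs₀ (by linarith)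
  have hderiv : ∀ s, 0 < s → HasDerivAt (fun s => (s ^ (n - 1) * w s))
      (((n - 1) / s - v s) * (s ^ (n - 1) * w s)) s := fun s hs => by
    have := hasDerivAt_radialDensity (n - 1) hs (hw s hs)
    rwa [hk] at this
  have hp0 : ∀ s, 0 ≤ s → 0 ≤ s ^ (n - 1) * w s := fun s hs =>
    mul_nonneg (pow_nonneg hs _) (hw0 s hs)
  have key := hardy_of_logDeriv_le (g := fun t => g (s₀ - t) - g s₀) (g' := fun t => -g' (s₀ - t))
    (p := fun t => (s₀ - t) ^ (n - 1) * w (s₀ - t))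
    (p' := fun t => -(((n - 1) / (s₀ - t) - v (s₀ - t)) * ((s₀ - t) ^ (n - 1) * w (s₀ - t))))
    (ℓ := s₀ / N) (T := s₀) hℓ hℓ'.le
    (fun s => ((hg (s₀ - s)).comp_const_sub s₀ s).sub_const _) (by fun_prop) (by simp)
    (by
      refine (continuousOn_radialDensity (n - 1) hwc).comp (f := fun t => s₀ - t)
        (by fun_prop) fun t ht => ?_
      have := ht.2
      simp only [Set.mem_Ici]
      linarith)
    (fun s hs => by
      have := hs.2
      exact HasDerivAt.comp_const_sub s₀ s (hderiv (s₀ - s) (by linarith)))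
    (fun s hs => hp0 _ (by have := hs.2; linarith))
    (fun s hs => by
      have h0 := hs.1
      have h00 := hs.2
      have h1 : s / (s₀ / N) < 1 := (div_lt_one hℓ).2 hs.2
      have h2 : 0 < s / (s₀ / N) := by positivity
      have h3 := hardy_near_bound hN1 h2 h1
      have hp := hp0 (s₀ - s) (by linarith)
      have hpos : 0 < s₀ - s := by linarith
      have h4 := hv (s₀ - s) hpos (by linarith)
      have h5 : (n / s₀ - (n - 1) / (s₀ - s)) * (s₀ / N)
          = (1 - N * (s / (s₀ / N))) / (N - s / (s₀ / N)) := by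
        rw [← hN2]
        have : N - s / (s₀ / N) = N * (s₀ - s) / s₀ := by field_simp
        rw [this]
        field_simp
        ring
      rw [← h5] at h3
      calc _ = (v (s₀ - s) - (n - 1) / (s₀ - s)) * ((s₀ - s) ^ (n - 1) * w (s₀ - s)) := by ring
        _ ≤ (n / s₀ - (n - 1) / (s₀ - s)) * ((s₀ - s) ^ (n - 1) * w (s₀ - s)) := by gcongr
        _ = (n / s₀ - (n - 1) / (s₀ - s)) * (s₀ / N)
              * ((s₀ - s) ^ (n - 1) * w (s₀ - s) / (s₀ / N)) := by
          field_simp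
        _ ≤ _ := mul_le_mul_of_nonneg_right h3 (by positivity))
    (fun s hs => by
      have h0 : 0 < s := hℓ.trans hs.1
      have hpos : 0 < s₀ - s := by linarith [hs.2]
      have hp := hp0 (s₀ - s) hpos.le
      have h3 : v (s₀ - s) - (n - 1) / (s₀ - s) ≤ -(N / s₀) := by
        have h4 := hv (s₀ - s) hpos (by linarith)
        have h5 : ((n : ℝ) - 1) / (s₀ - s₀ / N) ≤ (n - 1) / (s₀ - s) := by
          have := hs.1
          gcongr
          linarith
        have h6 : ((n : ℝ) - 1) / (s₀ - s₀ / N) = n / s₀ + N / s₀ := by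
          rw [← hN2]
          have : N - 1 ≠ 0 := by linarith
          have : s₀ - s₀ / N = s₀ * (N - 1) / N := by field_simp
          rw [this]
          field_simp
          ring
        linarith
      calc _ = (v (s₀ - s) - (n - 1) / (s₀ - s)) * ((s₀ - s) ^ (n - 1) * w (s₀ - s)) := by ring
        _ ≤ -(N / s₀) * ((s₀ - s) ^ (n - 1) * w (s₀ - s)) := mul_le_mul_of_nonneg_right h3 hp
        _ = _ := by field_simp)
  have c1 := intervalIntegral.integral_comp_sub_left (a := 0) (b := s₀)
    (fun s => (g s - g s₀) ^ 2 * (s ^ (n - 1) * w s)) s₀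
  have c2 := intervalIntegral.integral_comp_sub_left (a := 0) (b := s₀)
    (fun s => g' s ^ 2 * (s ^ (n - 1) * w s)) s₀
  simp only [sub_zero, sub_self] at c1 c2
  rw [← c1, ← c2]
  simp only [neg_sq] at key
  convert key using 2
  rw [← hN2]
  field_simp

theorem lintegral_Ioi_le_of_intervalIntegral_le {F G : ℝ → ℝ} {C T₀ : ℝ} (hC : 0 ≤ C)
    (hF : ContinuousOn F (Set.Ici 0)) (hG : ContinuousOn G (Set.Ici 0))
    (hF0 : ∀ s, 0 ≤ s → 0 ≤ F s) (hG0 : ∀ s, 0 ≤ s → 0 ≤ G s)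
    (h : ∀ T, T₀ ≤ T → ∫ s in 0..T, F s ≤ C * ∫ s in 0..T, G s) :
    ∫⁻ s in Set.Ioi 0, ENNReal.ofReal (F s)
      ≤ ENNReal.ofReal C * ∫⁻ s in Set.Ioi 0, ENNReal.ofReal (G s) := by
  have hm : AEMeasurable (fun s => ENNReal.ofReal (F s)) (volume.restrict (Set.Ioi 0)) :=
    ((hF.mono Set.Ioi_subset_Ici_self).aemeasurable measurableSet_Ioi).ennreal_ofReal
  have hlim := (aecover_Iic (μ := volume.restrict (Set.Ioi (0 : ℝ)))
    (Filter.tendsto_id (α := ℝ) (x := Filter.atTop))).lintegral_tendsto_of_countably_generated hm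
  refine le_of_tendsto hlim ?_
  filter_upwards [Filter.eventually_ge_atTop T₀, Filter.eventually_ge_atTop 0] with T hT hT0
  have hr : ∀ H : ℝ → ℝ, ContinuousOn H (Set.Ici 0) → (∀ s, 0 ≤ s → 0 ≤ H s) →
      ∫⁻ s in Set.Ioc 0 T, ENNReal.ofReal (H s) = ENNReal.ofReal (∫ s in 0..T, H s) := by
    intro H hH hH0
    rw [intervalIntegral.integral_of_le hT0, ofReal_integral_eq_lintegral_ofReal]
    · rw [← IntegrableOn, ← intervalIntegrable_iff_integrableOn_Ioc_of_le hT0]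
      refine (hH.mono ?_).intervalIntegrable
      rw [Set.uIcc_of_le hT0]
      exact Set.Icc_subset_Ici_self
    · filter_upwards [ae_restrict_mem measurableSet_Ioc] with s hs using hH0 s hs.1.le
  calc ∫⁻ s in Set.Iic T, ENNReal.ofReal (F s) ∂(volume.restrict (Set.Ioi 0))
      = ∫⁻ s in Set.Ioc 0 T, ENNReal.ofReal (F s) := by
        rw [Measure.restrict_restrict measurableSet_Iic, Set.inter_comm, Set.Ioi_inter_Iic]
    _ = ENNReal.ofReal (∫ s in 0..T, F s) := hr F hF hF0
    _ ≤ ENNReal.ofReal (C * ∫ s in 0..T, G s) := ENNReal.ofReal_le_ofReal (h T hT)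
    _ = ENNReal.ofReal C * ∫⁻ s in Set.Ioc 0 T, ENNReal.ofReal (G s) := by
        rw [ENNReal.ofReal_mul hC, hr G hG hG0]
    _ ≤ _ := by
        gcongr
        exact Set.Ioc_subset_Ioi_self

/-- Hardy inequality for the radial part of a rotation invariant log-concave measure on `ℝⁿ`,
with radial density `s ^ (n - 1) * w s`, `w' = - v w`, where `s₀` solves `s₀ * v s₀ = n`. -/
theorem exists_radial_hardy {w v : ℝ → ℝ} {n : ℕ} {s₀ : ℝ} (hn : 1 ≤ n) (hs₀ : 0 < s₀)
    (hwc : ContinuousOn w (Set.Ici 0)) (hw0 : ∀ s, 0 ≤ s → 0 ≤ w s)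
    (hw : ∀ s, 0 < s → HasDerivAt w (-(v s * w s)) s)
    (hv0 : ∀ s, 0 < s → 0 ≤ v s) (hv : ∀ s, s₀ ≤ s → n / s₀ ≤ v s)
    (hv' : ∀ s, 0 < s → s ≤ s₀ → v s ≤ n / s₀) :
    ∃ m : ℝ, (n = 1 → m = 0) ∧ ∀ g g' : ℝ → ℝ, (∀ s, HasDerivAt g (g' s) s) → Continuous g' →
      ∫⁻ s in Set.Ioi 0, ENNReal.ofReal ((g s - g m) ^ 2 * (s ^ (n - 1) * w s))
        ≤ ENNReal.ofReal (13 * s₀ ^ 2 / n) *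
          ∫⁻ s in Set.Ioi 0, ENNReal.ofReal (g' s ^ 2 * (s ^ (n - 1) * w s)) := by
  have hp := continuousOn_radialDensity (n - 1) hwc
  have hp0 : ∀ s, 0 ≤ s → 0 ≤ s ^ (n - 1) * w s := fun s hs =>
    mul_nonneg (pow_nonneg hs _) (hw0 s hs)
  suffices h : ∃ m T₀ : ℝ, (n = 1 → m = 0) ∧ ∀ T, T₀ ≤ T → ∀ g g' : ℝ → ℝ, (∀ s, HasDerivAt g (g' s) s) →
      Continuous g' → ∫ s in 0..T, (g s - g m) ^ 2 * (s ^ (n - 1) * w s)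
        ≤ 13 * s₀ ^ 2 / n * ∫ s in 0..T, g' s ^ 2 * (s ^ (n - 1) * w s) by
    obtain ⟨m, T₀, hm, h⟩ := h
    refine ⟨m, hm, fun g g' hg hg' => ?_⟩
    have hgc : Continuous g := continuous_iff_continuousAt.2 fun s => (hg s).continuousAt
    exact lintegral_Ioi_le_of_intervalIntegral_le (by positivity)
      (((hgc.sub continuous_const).pow 2).continuousOn.mul hp) ((hg'.pow 2).continuousOn.mul hp)
      (fun s hs => mul_nonneg (sq_nonneg _) (hp0 s hs))
      (fun s hs => mul_nonneg (sq_nonneg _) (hp0 s hs)) (fun T hT => h T hT g g' hg hg')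
  obtain rfl | hn2 := hn.eq_or_lt
  · refine ⟨0, s₀, fun _ => rfl, fun T hT g g' hg hg' => ?_⟩
    simp only [Nat.cast_one, one_div] at hv
    have key := hardy_of_logDeriv_le (g := fun t => g t - g 0) (g' := g') (p := w)
      (p' := fun s => -(v s * w s)) (T := T) hs₀ hT (fun s => (hg s).sub_const _) hg' (by simp)
      (hwc.mono Set.Icc_subset_Ici_self) (fun s hs => hw s hs.1) (fun s hs => hw0 s hs.1)
      (fun s hs => by
        have h0 := hs.1
        have h1 : s / s₀ < 1 := (div_lt_one hs₀).2 hs.2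
        have h2 : 0 < s / s₀ := by positivity
        have hws := hw0 s h0.le
        have h4 : 0 ≤ -((1 + 2 * (s / s₀)) / 6 - 20 / 13 / (1 + 2 * (s / s₀))) := by
          rw [neg_nonneg, sub_nonpos, div_le_div_iff₀ (by norm_num) (by positivity),
            div_mul_eq_mul_div, le_div_iff₀ (by norm_num)]
          nlinarith
        exact (neg_nonpos.2 (mul_nonneg (hv0 s h0) hws)).trans (mul_nonneg h4 (by positivity)))
      (fun s hs => by
        have hws := hw0 s (hs₀.trans hs.1).le
        have := mul_le_mul_of_nonneg_right (hv s hs.1.le) hws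
        rw [neg_le_neg_iff, div_eq_inv_mul]
        exact this)
    simpa using key
  · refine ⟨s₀, s₀ + s₀ / √n, fun h1 => by omega, fun T hT g g' hg hg' => ?_⟩
    have hgc : Continuous g := continuous_iff_continuousAt.2 fun s => (hg s).continuousAt
    have hr := radial_hardy_right hn2 hs₀ hT hg hg' hwc hw0 hw hv
    have hl := radial_hardy_left hn2 hs₀ hg hg' hwc hw0 hw hv'
    have hT' : s₀ ≤ T := le_trans (by simp; positivity) hT
    have ii : ∀ q : ℝ → ℝ, Continuous q → ∀ c d, 0 ≤ c → 0 ≤ d →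
        IntervalIntegrable (fun s => q s ^ 2 * (s ^ (n - 1) * w s)) volume c d := by
      intro q hq c d hc hd
      refine ((hq.pow 2).continuousOn.mul (hp.mono ?_)).intervalIntegrable
      intro s hs
      exact (le_min hc hd).trans hs.1
    have hd : Continuous fun s => g s - g s₀ := by fun_prop
    rw [← intervalIntegral.integral_add_adjacent_intervals (ii _ hd 0 s₀ le_rfl hs₀.le)
        (ii _ hd s₀ T hs₀.le (hs₀.le.trans hT')),
      ← intervalIntegral.integral_add_adjacent_intervals (ii g' hg' 0 s₀ le_rfl hs₀.le)
        (ii g' hg' s₀ T hs₀.le (hs₀.le.trans hT')), mul_add]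
    exact add_le_add hl hr

section Polar
open Metric

variable {E : Type*} [NormedAddCommGroup E] [InnerProductSpace ℝ E] [FiniteDimensional ℝ E]
  [MeasurableSpace E] [BorelSpace E] [Nontrivial E]

theorem lintegral_eq_lintegral_sphere_Ioi {F : E → ENNReal} (hF : Measurable F) :
    ∫⁻ x, F x = ∫⁻ θ, (∫⁻ s in Set.Ioi (0 : ℝ),
      ENNReal.ofReal (s ^ (Module.finrank ℝ E - 1)) * F (s • (θ : E)))
        ∂(volume : Measure E).toSphere := by
  have hmp := (volume : Measure E).measurePreserving_homeomorphUnitSphereProd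
  have hm : Measurable fun p : sphere (0 : E) 1 × Set.Ioi (0 : ℝ) => F (p.2.1 • (p.1 : E)) :=
    hF.comp (by fun_prop)
  calc ∫⁻ x, F x = ∫⁻ x in ({0}ᶜ : Set E), F x := by rw [restrict_compl_singleton]
    _ = ∫⁻ x : ({0}ᶜ : Set E), F x ∂(volume.comap Subtype.val) :=
        (lintegral_subtype_comap (measurableSet_singleton _).compl F).symm
    _ = ∫⁻ x : ({0}ᶜ : Set E), F ((homeomorphUnitSphereProd E x).2.1 •
          ((homeomorphUnitSphereProd E x).1 : E)) ∂(volume.comap Subtype.val) := by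
        refine lintegral_congr fun x => ?_
        have hx : ‖(x : E)‖ ≠ 0 := norm_ne_zero_iff.2 x.2
        simp [smul_smul, hx]
    _ = ∫⁻ p, F (p.2.1 • (p.1 : E)) ∂((volume : Measure E).toSphere.prod
          (Measure.volumeIoiPow (Module.finrank ℝ E - 1))) := hmp.lintegral_comp hm
    _ = ∫⁻ θ, ∫⁻ s, F (s.1 • (θ : E)) ∂(Measure.volumeIoiPow (Module.finrank ℝ E - 1))
          ∂(volume : Measure E).toSphere := lintegral_prod _ hm.aemeasurable
    _ = _ := by
        refine lintegral_congr fun θ => ?_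
        rw [Measure.volumeIoiPow, lintegral_withDensity_eq_lintegral_mul _ (by fun_prop)
          (g := fun s : Set.Ioi (0 : ℝ) => F (s.1 • (θ : E))) (hF.comp (by fun_prop))]
        exact lintegral_subtype_comap measurableSet_Ioi
          (fun s : ℝ => ENNReal.ofReal (s ^ (Module.finrank ℝ E - 1)) * F (s • (θ : E)))

/-- The uniform probability measure on the unit sphere. -/
noncomputable def sphereUniform (E : Type*) [NormedAddCommGroup E] [InnerProductSpace ℝ E]
    [FiniteDimensional ℝ E] [MeasurableSpace E] [BorelSpace E] : Measure (sphere (0 : E) 1) :=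
  ((volume : Measure E).toSphere Set.univ)⁻¹ • (volume : Measure E).toSphere

theorem toSphere_univ_ne_zero : (volume : Measure E).toSphere Set.univ ≠ 0 :=
  Measure.measure_univ_ne_zero.2 (Measure.toSphere_ne_zero _)

instance : IsProbabilityMeasure (sphereUniform E) :=
  ⟨by
    rw [sphereUniform, Measure.smul_apply, smul_eq_mul]
    exact ENNReal.inv_mul_cancel toSphere_univ_ne_zero (measure_ne_top _ _)⟩

/-- The law of the norm under the rotation invariant measure with density `h ‖x‖`. -/
noncomputable def radialLaw (E : Type*) [NormedAddCommGroup E] [InnerProductSpace ℝ E]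
    [FiniteDimensional ℝ E] [MeasurableSpace E] [BorelSpace E] (h : ℝ → ENNReal) : Measure ℝ :=
  (volume : Measure E).toSphere Set.univ • (volume.restrict (Set.Ioi 0)).withDensity
    fun s => ENNReal.ofReal (s ^ (Module.finrank ℝ E - 1)) * h s

instance (h : ℝ → ENNReal) : SFinite (radialLaw E h) := by
  unfold radialLaw; infer_instance

omit [Nontrivial E] in
theorem lintegral_radialLaw {h : ℝ → ENNReal} (hh : Measurable h) {F : ℝ → ENNReal}
    (hF : Measurable F) :
    ∫⁻ s, F s ∂(radialLaw E h) = (volume : Measure E).toSphere Set.univ *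
      ∫⁻ s in Set.Ioi (0 : ℝ), ENNReal.ofReal (s ^ (Module.finrank ℝ E - 1)) * h s * F s := by
  rw [radialLaw, lintegral_smul_measure, lintegral_withDensity_eq_lintegral_mul _
    (by fun_prop) hF]
  rfl

theorem lintegral_withDensity_norm {h : ℝ → ENNReal} (hh : Measurable h) {F : E → ENNReal}
    (hF : Measurable F) :
    ∫⁻ x, F x ∂(volume.withDensity fun x => h ‖x‖)
      = ∫⁻ θ, ∫⁻ s, F (s • (θ : E)) ∂(radialLaw E h) ∂(sphereUniform E) := by
  have hsph : ∀ θ : sphere (0 : E) 1, ‖(θ : E)‖ = 1 := fun θ => by simp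
  have h1 : ∀ θ : sphere (0 : E) 1, ∫⁻ s, F (s • (θ : E)) ∂(radialLaw E h)
      = (volume : Measure E).toSphere Set.univ * ∫⁻ s in Set.Ioi (0 : ℝ),
        ENNReal.ofReal (s ^ (Module.finrank ℝ E - 1)) *
          (h ‖s • (θ : E)‖ * F (s • (θ : E))) := by
    intro θ
    rw [lintegral_radialLaw hh (F := fun s => F (s • (θ : E))) (hF.comp (by fun_prop))]
    congr 1
    refine setLIntegral_congr_fun measurableSet_Ioi fun s hs => ?_
    have : ‖s • (θ : E)‖ = s := by rw [norm_smul, hsph, mul_one, Real.norm_of_nonneg hs.le]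
    simp only [this, mul_assoc]
  simp_rw [h1]
  rw [lintegral_const_mul' _ _ (measure_ne_top _ _), sphereUniform, lintegral_smul_measure,
    smul_eq_mul, ← mul_assoc, ENNReal.mul_inv_cancel toSphere_univ_ne_zero (measure_ne_top _ _),
    one_mul, lintegral_withDensity_eq_lintegral_mul _ (by fun_prop) hF,
    lintegral_eq_lintegral_sphere_Ioi (by fun_prop)]
  rfl

theorem map_smul_sphereUniform_prod_radialLaw {h : ℝ → ENNReal} (hh : Measurable h) :
    ((sphereUniform E).prod (radialLaw E h)).map (fun p => p.2 • (p.1 : E))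
      = volume.withDensity fun x => h ‖x‖ := by
  refine Measure.ext_of_lintegral _ fun F hF => ?_
  rw [lintegral_map hF (by fun_prop), lintegral_prod _ (by fun_prop),
    lintegral_withDensity_norm hh hF]

end Polar

section Gaussian
open ProbabilityTheory

variable {E : Type*} [NormedAddCommGroup E] [InnerProductSpace ℝ E] [FiniteDimensional ℝ E]
  [MeasurableSpace E] [BorelSpace E]

/-- The density of the standard Gaussian measure in dimension `d`, as a function of the norm. -/
noncomputable def stdGaussianRadialDensity (d : ℕ) (s : ℝ) : ENNReal :=
  ENNReal.ofReal ((2 * Real.pi) ^ (-(d / 2 : ℝ)) * Real.exp (-s ^ 2 / 2))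

theorem measurable_stdGaussianRadialDensity (d : ℕ) :
    Measurable (stdGaussianRadialDensity d) := by
  unfold stdGaussianRadialDensity; fun_prop

theorem stdGaussian_eq_withDensity :
    stdGaussian E
      = volume.withDensity fun x => stdGaussianRadialDensity (Module.finrank ℝ E) ‖x‖ := by
  have hpos : (0 : ℝ) < (2 * Real.pi) ^ ((Module.finrank ℝ E : ℝ) / 2) := by positivity
  have hinteg : ∫ x : E, (2 * Real.pi) ^ (-(Module.finrank ℝ E / 2 : ℝ)) *
      Real.exp (-‖x‖ ^ 2 / 2) = 1 := by
    have := GaussianFourier.integral_rexp_neg_mul_sq_norm (V := E) (b := 1 / 2) (by norm_num)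
    rw [integral_const_mul]
    simp_rw [show ∀ x : E, -‖x‖ ^ 2 / 2 = -(1 / 2) * ‖x‖ ^ 2 from fun x => by ring]
    rw [this, show Real.pi / (1 / 2) = 2 * Real.pi by ring, Real.rpow_neg (by positivity)]
    field_simp
  have hi : Integrable fun x : E => (2 * Real.pi) ^ (-(Module.finrank ℝ E / 2 : ℝ)) *
      Real.exp (-‖x‖ ^ 2 / 2) := by
    by_contra h
    rw [integral_undef h] at hinteg
    exact zero_ne_one hinteg
  have hfin : IsFiniteMeasure (volume.withDensity
      fun x : E => stdGaussianRadialDensity (Module.finrank ℝ E) ‖x‖) :=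
    isFiniteMeasure_withDensity_ofReal hi.2
  refine Measure.ext_of_charFun ?_
  ext t
  rw [charFun_stdGaussian, charFun_apply,
    integral_withDensity_eq_integral_toReal_smul
      (f := fun x : E => stdGaussianRadialDensity (Module.finrank ℝ E) ‖x‖)
      ((measurable_stdGaussianRadialDensity _).comp measurable_norm)
      (by simp [stdGaussianRadialDensity])]
  have h1 : ∀ x : E, (stdGaussianRadialDensity (Module.finrank ℝ E) ‖x‖).toReal •
      Complex.exp (inner ℝ x t * Complex.I)
      = (((2 * Real.pi) ^ (-(Module.finrank ℝ E / 2 : ℝ)) : ℝ) : ℂ) *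
        Complex.exp (-(1 / 2 : ℂ) * ‖x‖ ^ 2 + Complex.I * inner ℝ t x) := by
    intro x
    rw [stdGaussianRadialDensity, ENNReal.toReal_ofReal (by positivity), Complex.real_smul,
      Complex.exp_add, real_inner_comm]
    push_cast
    rw [show -(‖x‖ : ℂ) ^ 2 / 2 = -(1 / 2 : ℂ) * ‖x‖ ^ 2 by ring, mul_comm Complex.I]
    ring
  simp_rw [h1]
  rw [integral_const_mul, GaussianFourier.integral_cexp_neg_mul_sq_norm_add (by norm_num)]
  have h2 : ((Real.pi : ℂ) / (1 / 2)) ^ ((Module.finrank ℝ E : ℂ) / 2)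
      = (((2 * Real.pi) ^ ((Module.finrank ℝ E : ℝ) / 2) : ℝ) : ℂ) := by
    rw [Complex.ofReal_cpow (by positivity)]
    push_cast
    congr 1
    ring
  rw [h2, ← mul_assoc, ← Complex.ofReal_mul, Real.rpow_neg (by positivity),
    inv_mul_cancel₀ hpos.ne', Complex.I_sq]
  push_cast
  rw [one_mul]
  congr 1
  ring

theorem map_rotation_stdGaussian (t : ℝ) :
    ((stdGaussian E).prod (stdGaussian E)).map (ContinuousLinearMap.rotation t)
      = (stdGaussian E).prod (stdGaussian E) :=
  IsGaussian.map_rotation_eq_self (by simp) t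

theorem integral_inner_sq_stdGaussian (h : E) :
    ∫ y, (inner ℝ h y) ^ 2 ∂(stdGaussian E) = ‖h‖ ^ 2 := by
  have := variance_dual_stdGaussian (innerSL ℝ h)
  rw [variance_of_integral_eq_zero (by fun_prop) (integral_strongDual_stdGaussian _)] at this
  simpa using this

end Gaussian

theorem ofReal_sq_integral_mul_le {α : Type*} [MeasurableSpace α] {μ : Measure α} {f g : α → ℝ}
    (hf : AEMeasurable f μ) (hg : AEMeasurable g μ) :
    ENNReal.ofReal ((∫ x, f x * g x ∂μ) ^ 2)
      ≤ (∫⁻ x, ENNReal.ofReal (f x ^ 2) ∂μ) * ∫⁻ x, ENNReal.ofReal (g x ^ 2) ∂μ := by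
  have hsq : ∀ r : ℝ, ENNReal.ofReal (r ^ 2) = ‖r‖ₑ ^ (2 : ℝ) := by
    intro r
    rw [← sq_abs, ENNReal.ofReal_pow (abs_nonneg _), ← Real.norm_eq_abs, ofReal_norm]
    norm_cast
  simp_rw [hsq]
  have h1 : ‖∫ x, f x * g x ∂μ‖ₑ ≤ ∫⁻ x, ‖f x‖ₑ * ‖g x‖ₑ ∂μ := by
    refine (enorm_integral_le_lintegral_enorm _).trans_eq (lintegral_congr fun x => ?_)
    rw [enorm_mul]
  have h2 := h1.trans (ENNReal.lintegral_mul_le_Lp_mul_Lq μ Real.HolderConjugate.two_two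
    hf.enorm hg.enorm)
  refine (ENNReal.rpow_le_rpow h2 (by norm_num : (0 : ℝ) ≤ 2)).trans_eq ?_
  rw [ENNReal.mul_rpow_of_nonneg _ _ (by norm_num), ← ENNReal.rpow_mul, ← ENNReal.rpow_mul]
  norm_num

section Homogeneous

variable {E : Type*} [NormedAddCommGroup E] [InnerProductSpace ℝ E] [FiniteDimensional ℝ E]

/-- The gradient of the 1-homogeneous extension `z ↦ ‖z‖ * u (z / ‖z‖)`. -/
noncomputable def homogeneousGradient (u : E → ℝ) (z : E) : E :=
  u (‖z‖⁻¹ • z) • (‖z‖⁻¹ • z) + (gradient u (‖z‖⁻¹ • z)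
    - inner ℝ (gradient u (‖z‖⁻¹ • z)) (‖z‖⁻¹ • z) • (‖z‖⁻¹ • z))

theorem hasDerivAt_norm_mul_comp_normalize {u : E → ℝ} (hu : Differentiable ℝ u)
    {X : ℝ → E} {Y : E} {t : ℝ} (hX : HasDerivAt X Y t) (h0 : X t ≠ 0) :
    HasDerivAt (fun t => ‖X t‖ * u (‖X t‖⁻¹ • X t))
      (inner ℝ (homogeneousGradient u (X t)) Y) t := by
  have hn : ‖X t‖ ≠ 0 := norm_ne_zero_iff.2 h0
  have hN : HasDerivAt (fun t => ‖X t‖) (inner ℝ (‖X t‖⁻¹ • X t) Y) t := by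
    have h := (hX.norm_sq.sqrt (by positivity))
    simp only [Real.sqrt_sq (norm_nonneg _)] at h
    refine h.congr_deriv ?_
    rw [real_inner_smul_left]
    field_simp
  have hθ : HasDerivAt (fun t => ‖X t‖⁻¹ • X t) (‖X t‖⁻¹ • Y
      + (-inner ℝ (‖X t‖⁻¹ • X t) Y / ‖X t‖ ^ 2) • X t) t := (hN.inv hn).smul hX
  have hU := (hu (‖X t‖⁻¹ • X t)).hasGradientAt.hasFDerivAt.comp_hasDerivAt t hθ
  refine (hN.mul hU).congr_deriv ?_
  simp only [homogeneousGradient, InnerProductSpace.toDual_apply_apply, inner_add_left,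
    inner_sub_left, inner_add_right, real_inner_smul_left, real_inner_smul_right,
    Function.comp]
  field_simp
  ring

theorem norm_homogeneousGradient_sq {u : E → ℝ} {s : ℝ} (hs : 0 < s) {θ : E} (hθ : ‖θ‖ = 1) :
    ‖homogeneousGradient u (s • θ)‖ ^ 2
      = u θ ^ 2 + (‖gradient u θ‖ ^ 2 - inner ℝ (gradient u θ) θ ^ 2) := by
  have h1 : ‖s • θ‖⁻¹ • s • θ = θ := by
    rw [norm_smul, hθ, mul_one, Real.norm_of_nonneg hs.le, smul_smul, inv_mul_cancel₀ hs.ne',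
      one_smul]
  rw [homogeneousGradient, h1, ← real_inner_self_eq_norm_sq]
  simp only [inner_add_left, inner_add_right, inner_sub_left, inner_sub_right,
    real_inner_smul_left, real_inner_smul_right, real_inner_self_eq_norm_sq, norm_smul,
    hθ, Real.norm_eq_abs, mul_one, sq_abs, real_inner_comm θ (gradient u θ)]
  ring

theorem exists_norm_le_homogeneousGradient {u : E → ℝ} (hu : ContDiff ℝ 1 u) :
    ∃ C, ∀ z, ‖homogeneousGradient u z‖ ≤ C ∧ |u (‖z‖⁻¹ • z)| ≤ C := by
  have hg : Continuous (gradient u) :=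
    (InnerProductSpace.toDual ℝ E).symm.continuous.comp (hu.continuous_fderiv one_ne_zero)
  have hcu := hu.continuous
  obtain ⟨C, hC⟩ := (isCompact_closedBall (0 : E) 1).exists_bound_of_continuousOn
    (f := fun θ => u θ • θ + (gradient u θ - inner ℝ (gradient u θ) θ • θ))
    (by fun_prop)
  obtain ⟨C', hC'⟩ := (isCompact_closedBall (0 : E) 1).exists_bound_of_continuousOn
    (f := u) (by fun_prop)
  refine ⟨max C C', fun z => ?_⟩
  have hz : ‖z‖⁻¹ • z ∈ Metric.closedBall (0 : E) 1 := by
    rw [mem_closedBall_zero_iff, norm_smul, norm_inv, norm_norm]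
    exact inv_mul_le_one
  exact ⟨(hC _ hz).trans (le_max_left _ _), (hC' _ hz).trans (le_max_right _ _)⟩

theorem continuous_norm_mul_comp_normalize {u : E → ℝ} (hu : ContDiff ℝ 1 u) :
    Continuous fun z => ‖z‖ * u (‖z‖⁻¹ • z) := by
  obtain ⟨C, hC⟩ := exists_norm_le_homogeneousGradient hu
  rw [continuous_iff_continuousAt]
  intro z
  have hcu := hu.continuous
  by_cases hz : z = 0
  · subst hz
    rw [ContinuousAt]
    simp only [norm_zero, zero_mul]
    have hlim : Filter.Tendsto (fun z : E => ‖z‖ * C) (nhds 0) (nhds 0) := by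
      have : Continuous fun z : E => ‖z‖ * C := by fun_prop
      simpa using this.tendsto 0
    refine squeeze_zero_norm (fun z => ?_) hlim
    rw [norm_mul, norm_norm, Real.norm_eq_abs]
    exact mul_le_mul_of_nonneg_left (hC z).2 (norm_nonneg _)
  · have hn : ‖z‖ ≠ 0 := norm_ne_zero_iff.2 hz
    have h1 : ContinuousAt (fun z : E => ‖z‖⁻¹ • z) z :=
      (continuousAt_id.norm.inv₀ hn).smul continuousAt_id
    exact continuousAt_id.norm.mul
      (ContinuousAt.comp (f := fun z : E => ‖z‖⁻¹ • z) hcu.continuousAt h1)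

variable [MeasurableSpace E] [BorelSpace E]

theorem measurable_homogeneousGradient {u : E → ℝ} (hu : ContDiff ℝ 1 u) :
    Measurable (homogeneousGradient u) := by
  have hg : Continuous (gradient u) :=
    (InnerProductSpace.toDual ℝ E).symm.continuous.comp (hu.continuous_fderiv one_ne_zero)
  have hcu := hu.continuous
  have h1 : Measurable fun z : E => ‖z‖⁻¹ • z := by fun_prop
  have h2 : Continuous fun θ : E => u θ • θ + (gradient u θ - inner ℝ (gradient u θ) θ • θ) := by
    fun_prop
  exact h2.measurable.comp h1

theorem ofReal_sq_sub_norm_mul_comp_normalize_le {u : E → ℝ} (hu : ContDiff ℝ 1 u) {x : E}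
    (hx : x ≠ 0) (y : E) :
    ENNReal.ofReal ((‖y‖ * u (‖y‖⁻¹ • y) - ‖x‖ * u (‖x‖⁻¹ • x)) ^ 2)
      ≤ ENNReal.ofReal (Real.pi / 2) * ∫⁻ t in Set.Ioc 0 (Real.pi / 2),
        ENNReal.ofReal ((inner ℝ
          (homogeneousGradient u (ContinuousLinearMap.rotation t (x, y)).1)
          (ContinuousLinearMap.rotation t (x, y)).2) ^ 2) := by
  have hpi := Real.pi_pos
  obtain ⟨C, hC⟩ := exists_norm_le_homogeneousGradient hu
  set X : ℝ → E := fun t => Real.cos t • x + Real.sin t • y with hXdef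
  set Y : ℝ → E := fun t => -Real.sin t • x + Real.cos t • y with hYdef
  have hrot : ∀ t, ContinuousLinearMap.rotation t (x, y) = (X t, Y t) := fun t => by
    rw [ContinuousLinearMap.rotation_apply]
  simp_rw [hrot]
  have hXY : ∀ t, HasDerivAt X (Y t) t := fun t =>
    ((Real.hasDerivAt_cos t).smul_const x).add ((Real.hasDerivAt_sin t).smul_const y)
  have hYc : Continuous Y := by fun_prop
  have hXc : Continuous X := by fun_prop
  have hm : Measurable fun t => inner ℝ (homogeneousGradient u (X t)) (Y t) :=
    ((measurable_homogeneousGradient hu).comp hXc.measurable).inner hYc.measurable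
  have hinteg : IntervalIntegrable (fun t => inner ℝ (homogeneousGradient u (X t)) (Y t))
      volume 0 (Real.pi / 2) := by
    have hb : IntervalIntegrable (fun t => C * ‖Y t‖) volume 0 (Real.pi / 2) :=
      (by fun_prop : Continuous fun t => C * ‖Y t‖).intervalIntegrable _ _
    refine hb.mono_fun hm.aestronglyMeasurable (Filter.Eventually.of_forall fun t => ?_)
    refine (norm_inner_le_norm _ _).trans ?_
    change _ ≤ ‖C * ‖Y t‖‖
    rw [norm_mul, norm_norm]
    exact mul_le_mul_of_nonneg_right ((hC _).1.trans (le_abs_self _)) (norm_nonneg _)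
  have hsub : (Set.Ioo 0 (Real.pi / 2) ∩ {t | X t = 0}).Subsingleton := by
    rintro t₁ ⟨ht₁, h₁⟩ t₂ ⟨ht₂, h₂⟩
    have h : Real.sin (t₂ - t₁) • x = 0 := by
      have : Real.sin (t₂ - t₁) • x = Real.sin t₂ • X t₁ - Real.sin t₁ • X t₂ := by
        simp only [hXdef, Real.sin_sub]
        module
      rw [this, h₁, h₂, smul_zero, smul_zero, sub_zero]
    have h0 := (smul_eq_zero.1 h).resolve_right hx
    rw [Real.sin_eq_zero_iff_of_lt_of_lt (by linarith [ht₁.2, ht₂.1]) (by linarith [ht₁.1, ht₂.2])]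
      at h0
    linarith
  have hftc := integral_eq_of_hasDerivAt_off_countable_of_le
    (fun t => ‖X t‖ * u (‖X t‖⁻¹ • X t)) (fun t => inner ℝ (homogeneousGradient u (X t)) (Y t))
    (by positivity : 0 ≤ Real.pi / 2) hsub.countable
    ((continuous_norm_mul_comp_normalize hu).comp hXc).continuousOn
    (fun t ht => hasDerivAt_norm_mul_comp_normalize (hu.differentiable one_ne_zero) (hXY t)
      fun h => ht.2 ⟨ht.1, h⟩) hinteg
  have h0 : X 0 = x := by simp [hXdef]
  have h1 : X (Real.pi / 2) = y := by simp [hXdef]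
  rw [h0, h1, intervalIntegral.integral_of_le (by positivity)] at hftc
  rw [← hftc]
  have := ofReal_sq_integral_mul_le (μ := volume.restrict (Set.Ioc 0 (Real.pi / 2)))
    (f := fun _ => (1 : ℝ)) aemeasurable_const hm.aemeasurable
  simpa using this

end Homogeneous

section SphericalPoincare
open ProbabilityTheory

variable {E : Type*} [NormedAddCommGroup E] [InnerProductSpace ℝ E] [FiniteDimensional ℝ E]
  [MeasurableSpace E] [BorelSpace E] [Nontrivial E]

omit [Nontrivial E] in
theorem integrable_inner_sq_stdGaussian (h : E) :
    Integrable (fun y => (inner ℝ h y) ^ 2) (stdGaussian E) := by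
  have h2 : MemLp (fun y : E => y) 2 (stdGaussian E) := IsGaussian.memLp_two_id
  exact (h2.const_inner h).integrable_sq

omit [Nontrivial E] in
theorem integral_norm_sq_stdGaussian :
    ∫ x : E, ‖x‖ ^ 2 ∂(stdGaussian E) = Module.finrank ℝ E := by
  have h : ∀ x : E, ‖x‖ ^ 2 = ∑ i, inner ℝ (stdOrthonormalBasis ℝ E i) x ^ 2 := fun x => by
    rw [← (stdOrthonormalBasis ℝ E).sum_sq_norm_inner_right x]
    simp
  simp_rw [h]
  rw [integral_finsetSum _ fun i _ => integrable_inner_sq_stdGaussian _]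
  simp [integral_inner_sq_stdGaussian]

theorem lintegral_sq_sub_norm_mul_comp_normalize_le {u : E → ℝ} (hu : ContDiff ℝ 1 u) :
    ∫⁻ p : E × E, ENNReal.ofReal ((‖p.2‖ * u (‖p.2‖⁻¹ • p.2) - ‖p.1‖ * u (‖p.1‖⁻¹ • p.1)) ^ 2)
        ∂((stdGaussian E).prod (stdGaussian E))
      ≤ ENNReal.ofReal ((Real.pi / 2) ^ 2) *
        ∫⁻ x, ENNReal.ofReal (‖homogeneousGradient u x‖ ^ 2) ∂(stdGaussian E) := by
  set γ := stdGaussian E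
  have hpi := Real.pi_pos
  have hH := measurable_homogeneousGradient hu
  have hG : Measurable fun p : E × E =>
      ENNReal.ofReal ((inner ℝ (homogeneousGradient u p.1) p.2) ^ 2) := by fun_prop
  have hae : ∀ᵐ x ∂γ, x ≠ 0 := by
    have hac : γ ≪ volume := by
      rw [show γ = _ from stdGaussian_eq_withDensity]
      exact withDensity_absolutelyContinuous _ _
    exact hac.ae_le (Measure.ae_ne volume 0)
  have hae2 : ∀ᵐ p ∂(γ.prod γ), p.1 ≠ 0 :=
    Measure.quasiMeasurePreserving_fst.ae hae
  have hrotm : Measurable fun q : (E × E) × ℝ => ContinuousLinearMap.rotation q.2 q.1 := by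
    simp_rw [ContinuousLinearMap.rotation_apply]
    fun_prop
  calc ∫⁻ p : E × E, ENNReal.ofReal
        ((‖p.2‖ * u (‖p.2‖⁻¹ • p.2) - ‖p.1‖ * u (‖p.1‖⁻¹ • p.1)) ^ 2) ∂(γ.prod γ)
      ≤ ∫⁻ p : E × E, ENNReal.ofReal (Real.pi / 2) * (∫⁻ t in Set.Ioc 0 (Real.pi / 2),
        ENNReal.ofReal ((inner ℝ
          (homogeneousGradient u (ContinuousLinearMap.rotation t p).1)
          (ContinuousLinearMap.rotation t p).2) ^ 2)) ∂(γ.prod γ) := by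
        refine lintegral_mono_ae ?_
        filter_upwards [hae2] with p hp
        exact ofReal_sq_sub_norm_mul_comp_normalize_le hu hp p.2
    _ = ENNReal.ofReal (Real.pi / 2) * ∫⁻ t in Set.Ioc 0 (Real.pi / 2), (∫⁻ p : E × E,
        ENNReal.ofReal ((inner ℝ
          (homogeneousGradient u (ContinuousLinearMap.rotation t p).1)
          (ContinuousLinearMap.rotation t p).2) ^ 2) ∂(γ.prod γ)) := by
        rw [lintegral_const_mul' _ _ ENNReal.ofReal_ne_top, lintegral_lintegral_swap]
        exact (hG.comp hrotm).aemeasurable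
    _ = ENNReal.ofReal (Real.pi / 2) * ∫⁻ _ in Set.Ioc 0 (Real.pi / 2), (∫⁻ p : E × E,
        ENNReal.ofReal ((inner ℝ (homogeneousGradient u p.1) p.2) ^ 2) ∂(γ.prod γ)) := by
        congr 1
        refine lintegral_congr fun t => ?_
        conv_rhs => rw [← map_rotation_stdGaussian t]
        rw [lintegral_map hG (by fun_prop)]
    _ = ENNReal.ofReal (Real.pi / 2) * (ENNReal.ofReal (Real.pi / 2) * ∫⁻ p : E × E,
        ENNReal.ofReal ((inner ℝ (homogeneousGradient u p.1) p.2) ^ 2) ∂(γ.prod γ)) := by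
        rw [setLIntegral_const, Real.volume_Ioc, sub_zero]
        ring
    _ = _ := by
        rw [← mul_assoc, ← ENNReal.ofReal_mul (by positivity), sq,
          lintegral_prod _ hG.aemeasurable]
        congr 1
        refine lintegral_congr fun x => ?_
        rw [← integral_inner_sq_stdGaussian,
          ofReal_integral_eq_lintegral_ofReal (integrable_inner_sq_stdGaussian _)
            (Filter.Eventually.of_forall fun _ => sq_nonneg _)]

/-- Integration in polar coordinates against the standard Gaussian measure. -/
theorem exists_polar_stdGaussian (E : Type*) [NormedAddCommGroup E] [InnerProductSpace ℝ E]
    [FiniteDimensional ℝ E] [MeasurableSpace E] [BorelSpace E] [Nontrivial E] :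
    ∃ ν : Measure ℝ, IsProbabilityMeasure ν ∧ (∀ᵐ s ∂ν, 0 < s) ∧
      ((sphereUniform E).prod ν).map (fun p => p.2 • (p.1 : E)) = stdGaussian E := by
  have h := map_smul_sphereUniform_prod_radialLaw (E := E)
    (measurable_stdGaussianRadialDensity (Module.finrank ℝ E))
  rw [← stdGaussian_eq_withDensity] at h
  refine ⟨_, ⟨?_⟩, ?_, h⟩
  · have h1 := congrArg (fun m => m Set.univ) h
    rw [Measure.map_apply (by fun_prop) MeasurableSet.univ, Set.preimage_univ,
      ← Set.univ_prod_univ, Measure.prod_prod] at h1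
    simpa using h1
  · rw [radialLaw]
    refine Measure.ae_smul_measure ?_ _
    refine (withDensity_absolutelyContinuous _ _).ae_le ?_
    exact ae_restrict_mem measurableSet_Ioi


theorem integral_stdGaussian_polar {ν : Measure ℝ} [IsProbabilityMeasure ν]
    (hpos : ∀ᵐ s ∂ν, 0 < s)
    (hν : ((sphereUniform E).prod ν).map (fun p => p.2 • (p.1 : E)) = stdGaussian E)
    {G : E → ℝ} (hG : Measurable G) {φ : ℝ → ℝ} {ψ : E → ℝ}
    (h : ∀ s, 0 < s → ∀ θ : E, ‖θ‖ = 1 → G (s • θ) = φ s * ψ θ) :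
    ∫ x, G x ∂(stdGaussian E) = (∫ s, φ s ∂ν) * ∫ θ, ψ θ ∂(sphereUniform E) := by
  rw [← hν, integral_map (by fun_prop) hG.aestronglyMeasurable, mul_comm,
    ← integral_prod_mul (fun θ : Metric.sphere (0 : E) 1 => ψ θ) φ]
  refine integral_congr_ae ?_
  filter_upwards [Measure.quasiMeasurePreserving_snd.ae hpos] with p hp
  rw [h _ hp _ (by simp), mul_comm]

/-- A Poincaré inequality on the unit sphere, with a nearly optimal constant. -/
theorem integral_sq_sphereUniform_le {u : E → ℝ} (hu : ContDiff ℝ 1 u)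
    (h0 : ∫ θ, u θ ∂(sphereUniform E) = 0) :
    (Module.finrank ℝ E - 5 / 4) * ∫ θ, u θ ^ 2 ∂(sphereUniform E)
      ≤ 5 / 4 * ∫ θ, (‖gradient u θ‖ ^ 2 - inner ℝ (gradient u θ) (θ : E) ^ 2)
        ∂(sphereUniform E) := by
  obtain ⟨ν, hνp, hpos, hν⟩ := exists_polar_stdGaussian E
  obtain ⟨C, hC⟩ := exists_norm_le_homogeneousGradient hu
  set γ := stdGaussian E
  set F : E → ℝ := fun z => ‖z‖ * u (‖z‖⁻¹ • z) with hF
  have hFc : Continuous F := continuous_norm_mul_comp_normalize hu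
  have hgc : Continuous (gradient u) :=
    (InnerProductSpace.toDual ℝ E).symm.continuous.comp (hu.continuous_fderiv one_ne_zero)
  have hcu := hu.continuous
  have hHm := measurable_homogeneousGradient hu
  have hnorm : ∀ s, 0 < s → ∀ θ : E, ‖θ‖ = 1 → F (s • θ) = s * u θ := by
    intro s hs θ hθ
    have h1 : ‖s • θ‖ = s := by rw [norm_smul, hθ, mul_one, Real.norm_of_nonneg hs.le]
    rw [hF]
    simp only [h1]
    rw [smul_smul, inv_mul_cancel₀ hs.ne', one_smul]
  have hF1 : ∫ x, F x ∂γ = 0 := by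
    rw [integral_stdGaussian_polar hpos hν hFc.measurable hnorm, h0, mul_zero]
  have hs2 : ∫ s, s ^ 2 ∂ν = Module.finrank ℝ E := by
    rw [← integral_norm_sq_stdGaussian, integral_stdGaussian_polar hpos hν (by fun_prop)
      (φ := fun s => s ^ 2) (ψ := fun _ => 1)]
    · simp
    · intro s hs θ hθ
      rw [norm_smul, hθ, mul_one, Real.norm_of_nonneg hs.le, mul_one]
  have hF2 : ∫ x, F x ^ 2 ∂γ
      = Module.finrank ℝ E * ∫ θ, u θ ^ 2 ∂(sphereUniform E) := by
    rw [integral_stdGaussian_polar hpos hν (by fun_prop) (φ := fun s => s ^ 2)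
      (ψ := fun θ => u θ ^ 2), hs2]
    intro s hs θ hθ
    rw [hnorm s hs θ hθ, mul_pow]
  have hcompact : ∀ {g : E → ℝ}, Continuous g →
      Integrable (fun θ : Metric.sphere (0 : E) 1 => g θ) (sphereUniform E) := fun hg =>
    (by fun_prop : Continuous fun θ : Metric.sphere (0 : E) 1 => _).integrable_of_hasCompactSupport
      (HasCompactSupport.of_compactSpace _)
  have hH2 : ∫ x, ‖homogeneousGradient u x‖ ^ 2 ∂γ = ∫ θ, u θ ^ 2 ∂(sphereUniform E)
      + ∫ θ, (‖gradient u θ‖ ^ 2 - inner ℝ (gradient u θ) (θ : E) ^ 2) ∂(sphereUniform E) := by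
    rw [integral_stdGaussian_polar hpos hν (by fun_prop) (φ := fun _ => 1)
      (ψ := fun θ => u θ ^ 2 + (‖gradient u θ‖ ^ 2 - inner ℝ (gradient u θ) θ ^ 2)),
      ← integral_add]
    · simp
    · exact hcompact (g := fun θ => u θ ^ 2) (by fun_prop)
    · exact hcompact (g := fun θ => ‖gradient u θ‖ ^ 2 - inner ℝ (gradient u θ) θ ^ 2)
        (by fun_prop)
    · intro s hs θ hθ
      rw [norm_homogeneousGradient_sq hs hθ, one_mul]
  have hid : MemLp (fun y : E => y) 2 γ := IsGaussian.memLp_two_id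
  have hFL : MemLp F 2 γ := by
    refine MemLp.of_le_mul hid hFc.aestronglyMeasurable (c := C)
      (Filter.Eventually.of_forall fun z => ?_)
    rw [hF, norm_mul, norm_norm, mul_comm]
    exact mul_le_mul_of_nonneg_right (hC z).2 (norm_nonneg _)
  have hFi : Integrable F γ := hFL.integrable (by norm_num)
  have hFi2 : Integrable (fun x => F x ^ 2) γ := hFL.integrable_sq
  have hHi : Integrable (fun x => ‖homogeneousGradient u x‖ ^ 2) γ := by
    refine Integrable.of_bound (by fun_prop) (C ^ 2) (Filter.Eventually.of_forall fun z => ?_)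
    rw [norm_pow, norm_norm]
    exact pow_le_pow_left₀ (norm_nonneg _) (hC z).1 2
  have hexp : (fun p : E × E => (F p.2 - F p.1) ^ 2)
      = fun p => (F p.2 ^ 2 + F p.1 ^ 2) - 2 * (F p.1 * F p.2) := by
    ext p; ring
  have hi1 : Integrable (fun p : E × E => F p.2 ^ 2) (γ.prod γ) := hFi2.comp_snd γ
  have hi2 : Integrable (fun p : E × E => F p.1 ^ 2) (γ.prod γ) := hFi2.comp_fst γ
  have hi3 : Integrable (fun p : E × E => F p.1 * F p.2) (γ.prod γ) := hFi.mul_prod hFi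
  have hi12 : Integrable (fun p : E × E => F p.2 ^ 2 + F p.1 ^ 2) (γ.prod γ) := hi1.add hi2
  have hlhs : ∫ p : E × E, (F p.2 - F p.1) ^ 2 ∂(γ.prod γ)
      = 2 * (Module.finrank ℝ E * ∫ θ, u θ ^ 2 ∂(sphereUniform E)) := by
    rw [hexp, integral_sub hi12 (hi3.const_mul 2), integral_add hi1 hi2,
      integral_const_mul, integral_prod_mul, hF1,
      integral_fun_snd (fun x => F x ^ 2), integral_fun_fst (fun x => F x ^ 2), hF2]
    simp
    ring
  have hmain := lintegral_sq_sub_norm_mul_comp_normalize_le hu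
  have hinteg : Integrable (fun p : E × E => (F p.2 - F p.1) ^ 2) (γ.prod γ) := by
    rw [hexp]
    exact hi12.sub (hi3.const_mul 2)
  rw [← ofReal_integral_eq_lintegral_ofReal hHi (Filter.Eventually.of_forall fun _ => by positivity),
    ← ofReal_integral_eq_lintegral_ofReal hinteg
      (Filter.Eventually.of_forall fun _ => by positivity),
    ← ENNReal.ofReal_mul (by positivity), ENNReal.ofReal_le_ofReal_iff
      (mul_nonneg (by positivity) (integral_nonneg fun _ => by positivity)), hlhs, hH2] at hmain
  have hpi : (Real.pi / 2) ^ 2 ≤ 5 / 2 := by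
    have := Real.pi_lt_d2
    have := Real.pi_pos
    nlinarith
  have hpos' : 0 ≤ ∫ x, ‖homogeneousGradient u x‖ ^ 2 ∂γ :=
    integral_nonneg fun _ => by positivity
  rw [hH2] at hpos'
  nlinarith [mul_le_mul_of_nonneg_right hpi hpos']

end SphericalPoincare

section GibbsWeight
open Set

/-- The radial profile `exp (-k (Ω s - log (1 + Ω s)))` of the Gibbs measure. -/
noncomputable def gibbsWeight (k Ω s : ℝ) : ℝ :=
  Real.exp (-(k * (Ω * s - Real.log (1 + Ω * s))))

/-- Minus the logarithmic derivative of `gibbsWeight`. -/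
noncomputable def gibbsDrift (k Ω s : ℝ) : ℝ := k * Ω ^ 2 * s / (1 + Ω * s)

variable {k Ω : ℝ}

theorem hasDerivAt_gibbsWeight (hΩ : 0 < Ω) {s : ℝ} (hs : 0 ≤ s) :
    HasDerivAt (gibbsWeight k Ω) (-(gibbsDrift k Ω s * gibbsWeight k Ω s)) s := by
  have hpos : 0 < 1 + Ω * s := by positivity
  have h1 : HasDerivAt (fun s => 1 + Ω * s) Ω s := by
    simpa using ((hasDerivAt_id s).const_mul Ω).const_add 1
  have h2 : HasDerivAt (fun s => Ω * s) Ω s := by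
    simpa using (hasDerivAt_id s).const_mul Ω
  have h3 : HasDerivAt (fun s => -(k * (Ω * s - Real.log (1 + Ω * s))))
      (-(k * (Ω - Ω / (1 + Ω * s)))) s := ((h2.sub (h1.log hpos.ne')).const_mul k).neg
  refine h3.exp.congr_deriv ?_
  simp only [gibbsWeight, gibbsDrift]
  field_simp
  ring

theorem continuousOn_gibbsWeight (hΩ : 0 < Ω) : ContinuousOn (gibbsWeight k Ω) (Ici 0) :=
  fun _ hs => (hasDerivAt_gibbsWeight hΩ hs).continuousAt.continuousWithinAt

theorem measurable_gibbsWeight : Measurable (gibbsWeight k Ω) := by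
  unfold gibbsWeight; fun_prop

theorem gibbsDrift_nonneg (hk : 0 < k) (hΩ : 0 < Ω) {s : ℝ} (hs : 0 ≤ s) :
    0 ≤ gibbsDrift k Ω s := by
  unfold gibbsDrift; positivity

theorem monotoneOn_gibbsDrift (hk : 0 < k) (hΩ : 0 < Ω) : MonotoneOn (gibbsDrift k Ω) (Ici 0) := by
  intro s hs t ht hst
  have hs' : (0 : ℝ) ≤ s := hs
  have ht' : (0 : ℝ) ≤ t := ht
  unfold gibbsDrift
  rw [div_le_div_iff₀ (by positivity) (by positivity)]
  have : k * Ω ^ 2 * s ≤ k * Ω ^ 2 * t := by gcongr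
  linarith

theorem gibbsWeight_le (hk : 0 < k) (hΩ : 0 < Ω) {s : ℝ} (hs : 0 ≤ s) :
    gibbsWeight k Ω s ≤ Real.exp (k * Real.log 2) * Real.exp (-(k * Ω / 2) * s) := by
  rw [gibbsWeight, ← Real.exp_add, Real.exp_le_exp]
  have h1 : Real.log (1 + Ω * s) ≤ Real.log 2 + ((1 + Ω * s) / 2 - 1) := by
    have h2 : 0 < (1 + Ω * s) / 2 := by positivity
    have h3 := Real.log_le_sub_one_of_pos h2
    rw [Real.log_div (by positivity) (by norm_num)] at h3
    linarith
  nlinarith [mul_le_mul_of_nonneg_left h1 hk.le]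

theorem integrableOn_pow_mul_gibbsWeight (hk : 0 < k) (hΩ : 0 < Ω) (m : ℕ) :
    IntegrableOn (fun s => s ^ m * gibbsWeight k Ω s) (Ioi 0) := by
  have h := (integrableOn_rpow_mul_exp_neg_mul_rpow (p := 1) (s := m) (b := k * Ω / 2)
    (by have := Nat.cast_nonneg (α := ℝ) m; linarith) one_pos (by positivity)).const_mul
      (Real.exp (k * Real.log 2))
  refine Integrable.mono' h
    (by have := measurable_gibbsWeight (k := k) (Ω := Ω); fun_prop) ?_
  filter_upwards [ae_restrict_mem measurableSet_Ioi] with s hs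
  have hs' : (0 : ℝ) < s := hs
  have hw : 0 < gibbsWeight k Ω s := Real.exp_pos _
  rw [Real.norm_of_nonneg (by positivity), Real.rpow_one, Real.rpow_natCast]
  calc s ^ m * gibbsWeight k Ω s
      ≤ s ^ m * (Real.exp (k * Real.log 2) * Real.exp (-(k * Ω / 2) * s)) := by
        gcongr; exact gibbsWeight_le hk hΩ hs'.le
    _ = _ := by ring

theorem integral_gibbsDrift_mul (hk : 0 < k) (hΩ : 0 < Ω) {n : ℕ} (hn : 1 ≤ n) :
    IntegrableOn (fun s => gibbsDrift k Ω s * (s ^ n * gibbsWeight k Ω s)) (Ioi 0) ∧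
    ∫ s in Ioi 0, gibbsDrift k Ω s * (s ^ n * gibbsWeight k Ω s)
      = n * ∫ s in Ioi 0, s ^ (n - 1) * gibbsWeight k Ω s := by
  have hi := integrableOn_pow_mul_gibbsWeight hk hΩ
  have hmeas := measurable_gibbsWeight (k := k) (Ω := Ω)
  have hvm : Measurable (gibbsDrift k Ω) := by unfold gibbsDrift; fun_prop
  have hvi : IntegrableOn (fun s => gibbsDrift k Ω s * (s ^ n * gibbsWeight k Ω s)) (Ioi 0) := by
    refine Integrable.mono' ((hi n).const_mul (k * Ω)) (by fun_prop) ?_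
    filter_upwards [ae_restrict_mem measurableSet_Ioi] with s hs
    have hs' : (0 : ℝ) < s := hs
    have hw : 0 < gibbsWeight k Ω s := Real.exp_pos _
    have hv := gibbsDrift_nonneg hk hΩ hs'.le
    rw [Real.norm_of_nonneg (by positivity)]
    refine mul_le_mul_of_nonneg_right ?_ (by positivity)
    rw [gibbsDrift, div_le_iff₀ (by positivity)]
    nlinarith [mul_pos hk hΩ]
  refine ⟨hvi, ?_⟩
  have hd : ∀ s ∈ Ioi (0 : ℝ), HasDerivAt (fun s => s ^ n * gibbsWeight k Ω s)
      (n * (s ^ (n - 1) * gibbsWeight k Ω s)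
        - gibbsDrift k Ω s * (s ^ n * gibbsWeight k Ω s)) s := by
    intro s hs
    have hs' : (0 : ℝ) < s := hs
    refine (hasDerivAt_radialDensity n hs' (hasDerivAt_gibbsWeight hΩ hs'.le)).congr_deriv ?_
    obtain ⟨m, rfl⟩ := Nat.exists_eq_add_of_le' hn
    simp only [Nat.add_sub_cancel, pow_succ]
    field_simp
  have hd' : IntegrableOn (fun s => n * (s ^ (n - 1) * gibbsWeight k Ω s)
      - gibbsDrift k Ω s * (s ^ n * gibbsWeight k Ω s)) (Ioi 0) :=
    ((hi (n - 1)).const_mul _).sub hvi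
  have hlim := tendsto_zero_of_hasDerivAt_of_integrableOn_Ioi hd hd' (hi n)
  have h := integral_Ioi_of_hasDerivAt_of_tendsto
    (continuousOn_radialDensity n (continuousOn_gibbsWeight hΩ) 0 self_mem_Ici) hd hd' hlim
  rw [integral_sub ((hi (n - 1)).const_mul _) hvi, integral_const_mul,
    zero_pow (by omega), zero_mul, sub_zero] at h
  linarith

/-- The critical radius, at which the drift equals `n / s`. -/
theorem exists_gibbsDrift_eq (hk : 0 < k) (hΩ : 0 < Ω) {n : ℕ} (hn : 1 ≤ n) :
    ∃ s₀, 0 < s₀ ∧ k * Ω ^ 2 * s₀ ^ 2 = n * (1 + Ω * s₀) := by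
  have hn' : (1 : ℝ) ≤ n := by exact_mod_cast hn
  set κ := k * Ω ^ 2 with hκ
  have hκpos : 0 < κ := by positivity
  have hD : 0 ≤ (n * Ω) ^ 2 + 4 * κ * n := by positivity
  refine ⟨(n * Ω + √((n * Ω) ^ 2 + 4 * κ * n)) / (2 * κ), by positivity, ?_⟩
  have h := Real.sq_sqrt hD
  generalize √((n * Ω) ^ 2 + 4 * κ * n) = r at h ⊢
  field_simp
  linarith

theorem sq_mul_integral_gibbsWeight_le (hk : 0 < k) (hΩ : 0 < Ω) {n : ℕ} (hn : 1 ≤ n) {s₀ : ℝ}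
    (hs₀ : 0 < s₀) (h₀ : k * Ω ^ 2 * s₀ ^ 2 = n * (1 + Ω * s₀)) :
    s₀ ^ 2 * ∫ s in Ioi 0, s ^ (n - 1) * gibbsWeight k Ω s
      ≤ ∫ s in Ioi 0, s ^ (n + 1) * gibbsWeight k Ω s := by
  have hn' : (1 : ℝ) ≤ n := by exact_mod_cast hn
  have hi := integrableOn_pow_mul_gibbsWeight hk hΩ
  obtain ⟨hvi, hv⟩ := integral_gibbsDrift_mul hk hΩ hn
  have hmono : ∫ s in Ioi 0, ((1 + Ω * s₀) * s₀ ^ 2) *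
        (gibbsDrift k Ω s * (s ^ n * gibbsWeight k Ω s))
      ≤ ∫ s in Ioi 0, ((n * (Ω * s₀ / 2 * s₀ ^ 2)) * (s ^ (n - 1) * gibbsWeight k Ω s)
        + (n * (1 + Ω * s₀ / 2)) * (s ^ (n + 1) * gibbsWeight k Ω s)) := by
    refine setIntegral_mono_on (hvi.const_mul _)
      (((hi _).const_mul _).add ((hi _).const_mul _)) measurableSet_Ioi fun s hs => ?_
    have hs' : (0 : ℝ) < s := hs
    have hw : 0 < gibbsWeight k Ω s := Real.exp_pos _
    have hpt : (1 + Ω * s₀) * s₀ ^ 2 * (gibbsDrift k Ω s * s)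
        ≤ n * (Ω * s₀ / 2 * s₀ ^ 2) + n * (1 + Ω * s₀ / 2) * s ^ 2 := by
      rw [gibbsDrift, div_mul_eq_mul_div, mul_div_assoc', div_le_iff₀ (by positivity)]
      have e : (1 + Ω * s₀) * s₀ ^ 2 * (k * Ω ^ 2 * s * s)
          = n * ((1 + Ω * s₀) ^ 2 * s ^ 2) := by
        calc _ = (1 + Ω * s₀) * (k * Ω ^ 2 * s₀ ^ 2) * s ^ 2 := by ring
          _ = _ := by rw [h₀]; ring
      have e2 : (n * (Ω * s₀ / 2 * s₀ ^ 2) + n * (1 + Ω * s₀ / 2) * s ^ 2) * (1 + Ω * s)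
          - n * ((1 + Ω * s₀) ^ 2 * s ^ 2)
          = n * (Ω * (s - s₀) ^ 2 * (s + s₀ / 2) + Ω ^ 2 * s₀ / 2 * s * (s₀ - s) ^ 2) := by
        ring
      have : 0 ≤ n * (Ω * (s - s₀) ^ 2 * (s + s₀ / 2) + Ω ^ 2 * s₀ / 2 * s * (s₀ - s) ^ 2) := by
        positivity
      linarith
    have h3 := mul_le_mul_of_nonneg_right hpt
      (by positivity : 0 ≤ s ^ (n - 1) * gibbsWeight k Ω s)
    obtain ⟨m, rfl⟩ := Nat.exists_eq_add_of_le' hn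
    simp only [Nat.add_sub_cancel] at h3 ⊢
    calc _ = (1 + Ω * s₀) * s₀ ^ 2 * (gibbsDrift k Ω s * s) * (s ^ m * gibbsWeight k Ω s) := by
          ring
      _ ≤ _ := h3
      _ = _ := by ring
  rw [integral_const_mul, hv, integral_add ((hi _).const_mul _) ((hi _).const_mul _),
    integral_const_mul, integral_const_mul] at hmono
  set A := ∫ s in Ioi 0, s ^ (n - 1) * gibbsWeight k Ω s
  set B := ∫ s in Ioi 0, s ^ (n + 1) * gibbsWeight k Ω s
  have h4 : n * (1 + Ω * s₀ / 2) * (s₀ ^ 2 * A) ≤ n * (1 + Ω * s₀ / 2) * B := by linarith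
  exact le_of_mul_le_mul_left h4 (by positivity)

end GibbsWeight

theorem lintegral_sq_sub_le_add {α : Type*} [MeasurableSpace α] {ν : Measure α}
    [IsProbabilityMeasure ν] {g : α → ℝ} (hg : MemLp g 2 ν) (a c : ℝ) :
    ∫⁻ x, ENNReal.ofReal ((g x - c) ^ 2) ∂ν
      ≤ ∫⁻ x, ENNReal.ofReal ((g x - a) ^ 2) ∂ν
        + ENNReal.ofReal (((∫ x, g x ∂ν) - c) ^ 2) := by
  have hi : Integrable g ν := hg.integrable (by norm_num)
  have hsq : ∀ b, Integrable (fun x => (g x - b) ^ 2) ν := fun b =>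
    (hg.sub (memLp_const b)).integrable_sq
  have hexp : ∀ b, ∫ x, (g x - b) ^ 2 ∂ν
      = ∫ x, g x ^ 2 ∂ν - 2 * b * ∫ x, g x ∂ν + b ^ 2 := by
    intro b
    have e : ∀ x, (g x - b) ^ 2 = (g x ^ 2 - 2 * b * g x) + b ^ 2 := fun x => by ring
    have h1 : Integrable (fun x => g x ^ 2 - 2 * b * g x) ν :=
      hg.integrable_sq.sub (hi.const_mul _)
    simp_rw [e]
    rw [integral_add h1 (integrable_const _), integral_sub hg.integrable_sq (hi.const_mul _),
      integral_const_mul]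
    simp
  rw [← ofReal_integral_eq_lintegral_ofReal (hsq c)
      (Filter.Eventually.of_forall fun _ => sq_nonneg _),
    ← ofReal_integral_eq_lintegral_ofReal (hsq a)
      (Filter.Eventually.of_forall fun _ => sq_nonneg _),
    ← ENNReal.ofReal_add (integral_nonneg fun _ => sq_nonneg _) (sq_nonneg _), hexp, hexp]
  refine ENNReal.ofReal_le_ofReal ?_
  nlinarith [sq_nonneg ((∫ x, g x ∂ν) - a)]

section Radial

variable {E : Type*} [NormedAddCommGroup E] [InnerProductSpace ℝ E] [FiniteDimensional ℝ E]

theorem continuous_gradient {f : E → ℝ} (hf : ContDiff ℝ 1 f) : Continuous (gradient f) :=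
  (InnerProductSpace.toDual ℝ E).symm.continuous.comp (hf.continuous_fderiv one_ne_zero)

theorem hasDerivAt_comp_smul {f : E → ℝ} (hf : ContDiff ℝ 1 f) (θ : E) (s : ℝ) :
    HasDerivAt (fun s : ℝ => f (s • θ)) (inner ℝ (gradient f (s • θ)) θ) s := by
  have h1 := ((hf.differentiable one_ne_zero) (s • θ)).hasGradientAt.hasFDerivAt
  have h2 : HasDerivAt (fun s : ℝ => s • θ) θ s := by
    simpa using (hasDerivAt_id s).smul_const θ
  exact h1.comp_hasDerivAt s h2

theorem gradient_comp_smul_sub_const {f : E → ℝ} (hf : ContDiff ℝ 1 f) (s M : ℝ) (x : E) :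
    gradient (fun x => f (s • x) - M) x = s • gradient f (s • x) := by
  have h1 := ((hf.differentiable one_ne_zero) (s • x)).hasGradientAt.hasFDerivAt
  have h2 : HasFDerivAt (fun x : E => s • x) (s • ContinuousLinearMap.id ℝ E) x :=
    (hasFDerivAt_id x).const_smul s
  refine HasGradientAt.gradient (hasGradientAt_iff_hasFDerivAt.2
    (((h1.comp x h2).sub_const M).congr_fderiv ?_))
  ext y
  simp

variable [MeasurableSpace E] [BorelSpace E] [Nontrivial E]

theorem lintegral_sphere_sq_sub_average_le {f : E → ℝ} (hf : ContDiff ℝ 1 f)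
    (hn : 2 ≤ Module.finrank ℝ E) {s : ℝ} (hs : 0 < s) :
    ∫⁻ θ, ENNReal.ofReal ((s⁻¹ * (f (s • (θ : E))
        - ∫ θ', f (s • (θ' : E)) ∂(sphereUniform E))) ^ 2) ∂(sphereUniform E)
      ≤ ENNReal.ofReal (13 / Module.finrank ℝ E) *
        ∫⁻ θ, ENNReal.ofReal (‖gradient f (s • (θ : E))‖ ^ 2
          - inner ℝ (gradient f (s • (θ : E))) (θ : E) ^ 2) ∂(sphereUniform E) := by
  have hn' : (2 : ℝ) ≤ Module.finrank ℝ E := by exact_mod_cast hn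
  have hg := continuous_gradient hf
  have hcf := hf.continuous
  set M := ∫ θ', f (s • (θ' : E)) ∂(sphereUniform E)
  have hcompact : ∀ {g : E → ℝ}, Continuous g →
      Integrable (fun θ : Metric.sphere (0 : E) 1 => g θ) (sphereUniform E) := fun hg =>
    (by fun_prop : Continuous fun θ : Metric.sphere (0 : E) 1 => _).integrable_of_hasCompactSupport
      (HasCompactSupport.of_compactSpace _)
  have hu : ContDiff ℝ 1 fun x => f (s • x) - M := by fun_prop
  have h0 : ∫ θ, (fun x => f (s • x) - M) (θ : E) ∂(sphereUniform E) = 0 := by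
    change ∫ θ, (f (s • (θ : E)) - M) ∂(sphereUniform E) = 0
    rw [integral_sub (hcompact (g := fun x => f (s • x)) (by fun_prop)) (integrable_const _)]
    simp [M]
  have hmain := integral_sq_sphereUniform_le hu h0
  simp_rw [gradient_comp_smul_sub_const hf] at hmain
  have hTi := hcompact (g := fun θ => ‖gradient f (s • θ)‖ ^ 2
    - inner ℝ (gradient f (s • θ)) θ ^ 2) (by fun_prop)
  have hT0 : ∀ θ : Metric.sphere (0 : E) 1, 0 ≤ ‖gradient f (s • (θ : E))‖ ^ 2
      - inner ℝ (gradient f (s • (θ : E))) (θ : E) ^ 2 := by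
    intro θ
    have h1 := abs_real_inner_le_norm (gradient f (s • (θ : E))) (θ : E)
    rw [norm_eq_of_mem_sphere, mul_one] at h1
    rw [sub_nonneg]
    exact sq_le_sq.2 (h1.trans (le_abs_self _))
  have e1 : ∀ θ : Metric.sphere (0 : E) 1, ‖s • gradient f (s • (θ : E))‖ ^ 2
      - inner ℝ (s • gradient f (s • (θ : E))) (θ : E) ^ 2
      = s ^ 2 * (‖gradient f (s • (θ : E))‖ ^ 2
        - inner ℝ (gradient f (s • (θ : E))) (θ : E) ^ 2) := by
    intro θ
    rw [norm_smul, Real.norm_of_nonneg hs.le, real_inner_smul_left]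
    ring
  simp_rw [e1] at hmain
  rw [integral_const_mul] at hmain
  rw [← ofReal_integral_eq_lintegral_ofReal hTi (Filter.Eventually.of_forall hT0),
    ← ofReal_integral_eq_lintegral_ofReal
      (hcompact (g := fun θ => (s⁻¹ * (f (s • θ) - M)) ^ 2) (by fun_prop))
      (Filter.Eventually.of_forall fun _ => sq_nonneg _),
    ← ENNReal.ofReal_mul (by positivity)]
  refine ENNReal.ofReal_le_ofReal ?_
  simp_rw [mul_pow]
  rw [integral_const_mul]
  have hT : 0 ≤ ∫ θ, (‖gradient f (s • (θ : E))‖ ^ 2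
      - inner ℝ (gradient f (s • (θ : E))) (θ : E) ^ 2) ∂(sphereUniform E) :=
    integral_nonneg hT0
  set T := ∫ θ, (‖gradient f (s • (θ : E))‖ ^ 2
      - inner ℝ (gradient f (s • (θ : E))) (θ : E) ^ 2) ∂(sphereUniform E)
  set D := ∫ θ, (f (s • (θ : E)) - M) ^ 2 ∂(sphereUniform E)
  have hD : (Module.finrank ℝ E - 5 / 4) * (s⁻¹ ^ 2 * D) ≤ 5 / 4 * T := by
    have := mul_le_mul_of_nonneg_left hmain (by positivity : 0 ≤ s⁻¹ ^ 2)
    calc _ = s⁻¹ ^ 2 * ((Module.finrank ℝ E - 5 / 4) * D) := by ring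
      _ ≤ _ := this
      _ = _ := by field_simp
  have hD0 : 0 ≤ s⁻¹ ^ 2 * D := mul_nonneg (by positivity) (integral_nonneg fun _ => sq_nonneg _)
  rw [div_mul_eq_mul_div, le_div_iff₀ (by positivity)]
  nlinarith

theorem lintegral_sq_sub_integral_le_of_radial {ν : Measure ℝ} [IsProbabilityMeasure ν]
    (hpos : ∀ᵐ s ∂ν, 0 < s) {μ : Measure E} [IsProbabilityMeasure μ]
    (hμ : ((sphereUniform E).prod ν).map (fun p => p.2 • (p.1 : E)) = μ) {s₀ m : ℝ}
    (hs₀ : ENNReal.ofReal (s₀ ^ 2) ≤ ∫⁻ s, ENNReal.ofReal (s ^ 2) ∂ν)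
    (hm : Module.finrank ℝ E = 1 → m = 0)
    (hardy : ∀ g g' : ℝ → ℝ, (∀ s, HasDerivAt g (g' s) s) → Continuous g' →
      ∫⁻ s, ENNReal.ofReal ((g s - g m) ^ 2) ∂ν
        ≤ ENNReal.ofReal (13 * s₀ ^ 2 / Module.finrank ℝ E) *
          ∫⁻ s, ENNReal.ofReal (g' s ^ 2) ∂ν)
    {f : E → ℝ} (hf : ContDiff ℝ 1 f) (hfL : MemLp f 2 μ) :
    ∫⁻ x, ENNReal.ofReal ((f x - ∫ y, f y ∂μ) ^ 2) ∂μ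
      ≤ ENNReal.ofReal (13 / Module.finrank ℝ E) * (∫⁻ s, ENNReal.ofReal (s ^ 2) ∂ν) *
        ∫⁻ x, ENNReal.ofReal (‖gradient f x‖ ^ 2) ∂μ := by
  have hg := continuous_gradient hf
  have hcf := hf.continuous
  set τ := sphereUniform E
  set S := ∫⁻ s, ENNReal.ofReal (s ^ 2) ∂ν
  set c := ∫ y, f y ∂μ with hc
  set K := ENNReal.ofReal (13 / Module.finrank ℝ E)
  have hpolar : ∀ {F : E → ℝ}, Continuous F → ∫⁻ x, ENNReal.ofReal (F x) ∂μ
      = ∫⁻ θ, ∫⁻ s, ENNReal.ofReal (F (s • (θ : E))) ∂ν ∂τ := by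
    intro F hF
    rw [← hμ, lintegral_map (by fun_prop) (by fun_prop), lintegral_prod _ (by fun_prop)]
  have hrad : ∀ θ : Metric.sphere (0 : E) 1,
      ∫⁻ s, ENNReal.ofReal ((f (s • (θ : E)) - f (m • (θ : E))) ^ 2) ∂ν
        ≤ K * S * ∫⁻ s, ENNReal.ofReal (inner ℝ (gradient f (s • (θ : E))) (θ : E) ^ 2) ∂ν := by
    intro θ
    refine (hardy _ _ (hasDerivAt_comp_smul hf (θ : E)) (by fun_prop)).trans ?_
    gcongr
    rw [mul_div_right_comm, ENNReal.ofReal_mul (by positivity)]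
    gcongr
  rcases Nat.lt_or_ge (Module.finrank ℝ E) 2 with hn | hn
  · have hn1 : Module.finrank ℝ E = 1 := by
      have := Module.finrank_pos (R := ℝ) (M := E)
      omega
    have h1 := lintegral_sq_sub_le_add hfL (f 0) c
    rw [← hc, sub_self, zero_pow two_ne_zero, ENNReal.ofReal_zero, add_zero] at h1
    refine h1.trans ?_
    rw [hpolar (F := fun x => (f x - f 0) ^ 2) (by fun_prop),
      hpolar (F := fun x => ‖gradient f x‖ ^ 2) (by fun_prop),
      ← lintegral_const_mul _ (Measurable.lintegral_prod_right (by fun_prop))]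
    refine lintegral_mono fun θ => ?_
    have h2 := hrad θ
    rw [hm hn1, zero_smul] at h2
    refine h2.trans (mul_le_mul' le_rfl (lintegral_mono fun s => ENNReal.ofReal_le_ofReal ?_))
    have h3 := abs_real_inner_le_norm (gradient f (s • (θ : E))) (θ : E)
    rw [norm_eq_of_mem_sphere, mul_one] at h3
    exact sq_le_sq.2 (h3.trans (le_abs_self _))
  · have hfi : Integrable (fun p : Metric.sphere (0 : E) 1 × ℝ => f (p.2 • (p.1 : E)))
        (τ.prod ν) := by
      have h1 : Integrable f μ := hfL.integrable (by norm_num)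
      rw [← hμ] at h1
      exact h1.comp_measurable (by fun_prop)
    have hfi2 : Integrable (fun p : Metric.sphere (0 : E) 1 × ℝ => f (p.2 • (p.1 : E)) ^ 2)
        (τ.prod ν) := by
      have h1 : Integrable (fun x => f x ^ 2) μ := hfL.integrable_sq
      rw [← hμ] at h1
      exact h1.comp_measurable (by fun_prop)
    set M : ℝ → ℝ := fun s => ∫ θ, f (s • (θ : E)) ∂τ
    have hMm : Measurable M := by
      have : StronglyMeasurable fun p : ℝ × Metric.sphere (0 : E) 1 => f (p.1 • (p.2 : E)) :=
        (by fun_prop : Continuous _).stronglyMeasurable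
      exact this.integral_prod_right.measurable
    have hMi : Integrable M ν := hfi.integral_prod_right
    have hcM : c = ∫ s, M s ∂ν := by
      have h1 := integral_map (μ := τ.prod ν) (φ := fun p => p.2 • (p.1 : E)) (by fun_prop)
        hcf.aestronglyMeasurable
      rw [hμ, ← hc] at h1
      rw [h1]
      exact integral_prod_symm _ hfi
    have hθ : ∀ᵐ θ : Metric.sphere (0 : E) 1 ∂τ,
        ∫⁻ s, ENNReal.ofReal ((f (s • (θ : E)) - c) ^ 2) ∂ν
        ≤ K * S * (∫⁻ s, ENNReal.ofReal (inner ℝ (gradient f (s • (θ : E))) (θ : E) ^ 2) ∂ν)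
          + S * ∫⁻ s, ENNReal.ofReal ((s⁻¹ * (f (s • (θ : E)) - M s)) ^ 2) ∂ν := by
      filter_upwards [hfi2.prod_right_ae, hfi.prod_right_ae] with θ h2 h1
      have hL : MemLp (fun s : ℝ => f (s • (θ : E))) 2 ν :=
        (memLp_two_iff_integrable_sq (by fun_prop)).2 h2
      refine (lintegral_sq_sub_le_add hL (f (m • (θ : E))) c).trans
        (add_le_add (hrad θ) ?_)
      have e : (∫ s, f (s • (θ : E)) ∂ν) - c
          = ∫ s, s * (s⁻¹ * (f (s • (θ : E)) - M s)) ∂ν := by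
        rw [hcM, ← integral_sub h1 hMi]
        refine integral_congr_ae ?_
        filter_upwards [hpos] with s hs
        rw [mul_inv_cancel_left₀ hs.ne']
      rw [e]
      exact ofReal_sq_integral_mul_le aemeasurable_id (by fun_prop)
    have htan : ∫⁻ θ, ∫⁻ s, ENNReal.ofReal ((s⁻¹ * (f (s • (θ : E)) - M s)) ^ 2) ∂ν ∂τ
        ≤ K * ∫⁻ θ, ∫⁻ s, ENNReal.ofReal (‖gradient f (s • (θ : E))‖ ^ 2
          - inner ℝ (gradient f (s • (θ : E))) (θ : E) ^ 2) ∂ν ∂τ := by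
      rw [lintegral_lintegral_swap (by fun_prop)]
      conv_rhs => rw [lintegral_lintegral_swap (by fun_prop)]
      rw [← lintegral_const_mul _ (Measurable.lintegral_prod_right (by fun_prop))]
      refine lintegral_mono_ae ?_
      filter_upwards [hpos] with s hs
      exact lintegral_sphere_sq_sub_average_le hf hn hs
    rw [hpolar (F := fun x => (f x - c) ^ 2) (by fun_prop),
      hpolar (F := fun x => ‖gradient f x‖ ^ 2) (by fun_prop)]
    refine (lintegral_mono_ae hθ).trans ?_
    rw [lintegral_add_left (Measurable.const_mul
        (Measurable.lintegral_prod_right (by fun_prop)) _),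
      lintegral_const_mul _ (Measurable.lintegral_prod_right (by fun_prop)),
      lintegral_const_mul _ (Measurable.lintegral_prod_right (by fun_prop))]
    refine (add_le_add_right (mul_le_mul_right htan S) _).trans_eq ?_
    rw [← mul_assoc, mul_comm S K, ← mul_add,
      ← lintegral_add_left (Measurable.lintegral_prod_right (by fun_prop))]
    congr 1
    refine lintegral_congr fun θ => ?_
    rw [← lintegral_add_left (by fun_prop)]
    refine lintegral_congr fun s => ?_
    have h3 := abs_real_inner_le_norm (gradient f (s • (θ : E))) (θ : E)
    rw [norm_eq_of_mem_sphere, mul_one] at h3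
    rw [← ENNReal.ofReal_add (sq_nonneg _)
      (sub_nonneg.2 (sq_le_sq.2 (h3.trans (le_abs_self _))))]
    congr 1
    ring

end Radial

section Gibbs

variable {E : Type*} [NormedAddCommGroup E] [InnerProductSpace ℝ E] [FiniteDimensional ℝ E]
  [MeasurableSpace E] [BorelSpace E] [Nontrivial E]

/-- Poincaré inequality for the probability measure with density `z * gibbsWeight k Ω ‖x‖`. -/
theorem lintegral_sq_sub_integral_le_of_gibbsWeight {k Ω z : ℝ} (hk : 0 < k) (hΩ : 0 < Ω)
    (hz : 0 < z) {μ : Measure E} [IsProbabilityMeasure μ]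
    (hμ : μ = volume.withDensity fun x => ENNReal.ofReal (z * gibbsWeight k Ω ‖x‖)) :
    ∫⁻ x, ENNReal.ofReal (‖x‖ ^ 2) ∂μ < ⊤ ∧
    ∀ f : E → ℝ, ContDiff ℝ 1 f → MemLp f 2 μ →
      ∫⁻ x, ENNReal.ofReal ((f x - ∫ y, f y ∂μ) ^ 2) ∂μ
        ≤ ENNReal.ofReal (13 / Module.finrank ℝ E) * (∫⁻ x, ENNReal.ofReal (‖x‖ ^ 2) ∂μ) *
          ∫⁻ x, ENNReal.ofReal (‖gradient f x‖ ^ 2) ∂μ := by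
  set n := Module.finrank ℝ E with hn_def
  have hn : 1 ≤ n := Module.finrank_pos
  have hn' : (1 : ℝ) ≤ n := by exact_mod_cast hn
  have hwm := measurable_gibbsWeight (k := k) (Ω := Ω)
  have hw0 : ∀ s, 0 ≤ gibbsWeight k Ω s := fun s => (Real.exp_pos _).le
  set h : ℝ → ENNReal := fun s => ENNReal.ofReal (z * gibbsWeight k Ω s) with hh
  have hhm : Measurable h := by fun_prop
  set ν := radialLaw E h
  have hpolar : ((sphereUniform E).prod ν).map (fun p => p.2 • (p.1 : E)) = μ := by
    rw [hμ]
    exact map_smul_sphereUniform_prod_radialLaw hhm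
  have hνp : IsProbabilityMeasure ν := by
    have h1 := congrArg (fun m => m Set.univ) hpolar
    rw [Measure.map_apply (by fun_prop) MeasurableSet.univ, Set.preimage_univ,
      ← Set.univ_prod_univ, Measure.prod_prod] at h1
    exact ⟨by simpa using h1⟩
  have hpos : ∀ᵐ s ∂ν, 0 < s := by
    refine Measure.ae_smul_measure ?_ _
    exact (withDensity_absolutelyContinuous _ _).ae_le (ae_restrict_mem measurableSet_Ioi)
  have hνint : ∀ F : ℝ → ℝ, Measurable F → ∫⁻ s, ENNReal.ofReal (F s) ∂ν
      = (volume : Measure E).toSphere Set.univ * (ENNReal.ofReal z *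
        ∫⁻ s in Set.Ioi 0, ENNReal.ofReal (F s * (s ^ (n - 1) * gibbsWeight k Ω s))) := by
    intro F hF
    rw [lintegral_radialLaw hhm (by fun_prop), ← lintegral_const_mul' _ _ ENNReal.ofReal_ne_top]
    congr 1
    refine setLIntegral_congr_fun measurableSet_Ioi fun s hs => ?_
    have hs' : (0 : ℝ) < s := hs
    simp only [hh]
    rw [← ENNReal.ofReal_mul (by positivity), ← ENNReal.ofReal_mul hz.le,
      ← ENNReal.ofReal_mul (mul_nonneg (by positivity) (mul_nonneg hz.le (hw0 s)))]
    congr 1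
    ring
  obtain ⟨s₀, hs₀, h₀⟩ := exists_gibbsDrift_eq hk hΩ hn
  have hdrift : gibbsDrift k Ω s₀ = n / s₀ := by
    rw [gibbsDrift, div_eq_div_iff (by positivity) (by positivity)]
    linarith
  obtain ⟨m, hm, hardy⟩ := exists_radial_hardy hn hs₀ (continuousOn_gibbsWeight (k := k) hΩ)
    (fun s _ => hw0 s) (fun s hs => hasDerivAt_gibbsWeight hΩ hs.le)
    (fun s hs => gibbsDrift_nonneg hk hΩ hs.le)
    (fun s hs => hdrift ▸ monotoneOn_gibbsDrift hk hΩ hs₀.le (hs₀.le.trans hs) hs)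
    (fun s hs hs' => hdrift ▸ monotoneOn_gibbsDrift hk hΩ hs.le hs₀.le hs')
  have hmoment : ∫⁻ x, ENNReal.ofReal (‖x‖ ^ 2) ∂μ = ∫⁻ s, ENNReal.ofReal (s ^ 2) ∂ν := by
    rw [← hpolar, lintegral_map (by fun_prop) (by fun_prop), lintegral_prod _ (by fun_prop)]
    simp [norm_smul]
  have hlint : ∀ j : ℕ, ∫⁻ s in Set.Ioi 0, ENNReal.ofReal (s ^ j * gibbsWeight k Ω s)
      = ENNReal.ofReal (∫ s in Set.Ioi 0, s ^ j * gibbsWeight k Ω s) := fun j =>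
    (ofReal_integral_eq_lintegral_ofReal (integrableOn_pow_mul_gibbsWeight hk hΩ j) (by
      filter_upwards [ae_restrict_mem measurableSet_Ioi] with s hs
      have hs' : (0 : ℝ) < s := hs
      exact mul_nonneg (by positivity) (hw0 s))).symm
  have hS : ∫⁻ s, ENNReal.ofReal (s ^ 2) ∂ν
      = (volume : Measure E).toSphere Set.univ * (ENNReal.ofReal z *
        ENNReal.ofReal (∫ s in Set.Ioi 0, s ^ (n + 1) * gibbsWeight k Ω s)) := by
    rw [hνint _ (by fun_prop), ← hlint]
    simp_rw [← mul_assoc, ← pow_add]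
    rw [show 2 + (n - 1) = n + 1 by omega]
  have hs₀S : ENNReal.ofReal (s₀ ^ 2) ≤ ∫⁻ s, ENNReal.ofReal (s ^ 2) ∂ν := by
    have h1 : ENNReal.ofReal (s₀ ^ 2) = ∫⁻ _, ENNReal.ofReal (s₀ ^ 2) ∂ν := by simp
    rw [h1, hνint _ measurable_const, hS]
    gcongr
    simp_rw [ENNReal.ofReal_mul (sq_nonneg s₀)]
    rw [lintegral_const_mul' _ _ ENNReal.ofReal_ne_top, hlint, ← ENNReal.ofReal_mul (sq_nonneg s₀)]
    exact ENNReal.ofReal_le_ofReal (sq_mul_integral_gibbsWeight_le hk hΩ hn hs₀ h₀)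
  rw [hmoment]
  refine ⟨?_, fun f hf hfL => ?_⟩
  · rw [hS]
    exact ENNReal.mul_lt_top (measure_lt_top _ _)
      (ENNReal.mul_lt_top ENNReal.ofReal_lt_top ENNReal.ofReal_lt_top)
  · refine lintegral_sq_sub_integral_le_of_radial hpos hpolar hs₀S hm (fun g g' hg hg' => ?_)
      hf hfL
    have hgc : Continuous g := continuous_iff_continuousAt.2 fun s => (hg s).continuousAt
    rw [hνint _ (by fun_prop), hνint _ (by fun_prop)]
    refine (mul_le_mul' le_rfl (mul_le_mul' le_rfl (hardy g g' hg hg'))).trans_eq ?_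
    ring

end Gibbs

/-- Poincaré inequality for the Gibbs measure `μ ∝ exp(-V/(2δ))` of the potential
`V(r) = (2aρ/Ω²)(Ω‖r‖₂ - log(1 + Ω‖r‖₂))`: with `σ² = ∫ ‖r‖₂² dμ`, for every `C¹`
function `f` which is square-integrable with square-integrable gradient,
`Var_μ(f) ≤ (13σ²/n) ∫ ‖∇f‖₂² dμ`. -/
theorem gibbs_measure_poincare {n : ℕ} (hn : 1 ≤ n) (a ρ Ω δ : ℝ)
    (ha : 0 < a) (hρ : 0 < ρ) (hΩ : 0 < Ω) (hδ : 0 < δ)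
    (V : EuclideanSpace ℝ (Fin n) → ℝ)
    (hV : ∀ r, V r = (2 * a * ρ / Ω ^ 2) * (Ω * ‖r‖ - Real.log (1 + Ω * ‖r‖)))
    (hVint : Integrable (fun r : EuclideanSpace ℝ (Fin n) =>
      Real.exp (-(V r) / (2 * δ))))
    (Z : ℝ) (hZ : Z = ∫ r : EuclideanSpace ℝ (Fin n), Real.exp (-(V r) / (2 * δ)))
    (μ : Measure (EuclideanSpace ℝ (Fin n)))
    (hμ : μ = volume.withDensity
      (fun r => ENNReal.ofReal (Z⁻¹ * Real.exp (-(V r) / (2 * δ)))))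
    (σsq : ℝ) (hσsq : σsq = ∫ r, ‖r‖ ^ 2 ∂μ)
    (f : EuclideanSpace ℝ (Fin n) → ℝ) (hf : ContDiff ℝ 1 f)
    (hfsq : Integrable (fun r => (f r) ^ 2) μ)
    (hgradsq : Integrable (fun r => ‖gradient f r‖ ^ 2) μ) :
    ∫ r, (f r - ∫ r', f r' ∂μ) ^ 2 ∂μ ≤ (13 * σsq / n) * ∫ r, ‖gradient f r‖ ^ 2 ∂μ := by
  have : Nonempty (Fin n) := ⟨⟨0, hn⟩⟩
  have hZpos : 0 < Z := by
    rw [hZ]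
    exact integral_exp_pos hVint
  have hcf := hf.continuous
  have hprob : IsProbabilityMeasure μ := by
    refine ⟨?_⟩
    rw [hμ, withDensity_apply _ MeasurableSet.univ, Measure.restrict_univ,
      ← ofReal_integral_eq_lintegral_ofReal (hVint.const_mul _)
        (Filter.Eventually.of_forall fun _ => by positivity),
      integral_const_mul, ← hZ, inv_mul_cancel₀ hZpos.ne', ENNReal.ofReal_one]
  have hweight : ∀ r, Real.exp (-(V r) / (2 * δ)) = gibbsWeight (a * ρ / (δ * Ω ^ 2)) Ω ‖r‖ := by
    intro r
    rw [gibbsWeight, hV]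
    congr 1
    field_simp
  simp_rw [hweight] at hμ
  obtain ⟨hfin, hmain⟩ := lintegral_sq_sub_integral_le_of_gibbsWeight (by positivity) hΩ
    (inv_pos.2 hZpos) hμ
  have hfL : MemLp f 2 μ := (memLp_two_iff_integrable_sq hcf.aestronglyMeasurable).2 hfsq
  have hσi : Integrable (fun r : EuclideanSpace ℝ (Fin n) => ‖r‖ ^ 2) μ :=
    (lintegral_ofReal_ne_top_iff_integrable (by fun_prop)
      (Filter.Eventually.of_forall fun _ => by positivity)).1 hfin.ne
  have hσ0 : 0 ≤ σsq := hσsq ▸ integral_nonneg fun _ => by positivity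
  have hdi : Integrable (fun r => (f r - ∫ r', f r' ∂μ) ^ 2) μ :=
    (hfL.sub (memLp_const _)).integrable_sq
  have h := hmain f hf hfL
  rw [finrank_euclideanSpace_fin, ← ofReal_integral_eq_lintegral_ofReal hσi
      (Filter.Eventually.of_forall fun _ => by positivity), ← hσsq,
    ← ofReal_integral_eq_lintegral_ofReal hgradsq
      (Filter.Eventually.of_forall fun _ => by positivity),
    ← ofReal_integral_eq_lintegral_ofReal hdi
      (Filter.Eventually.of_forall fun _ => sq_nonneg _),
    ← ENNReal.ofReal_mul (by positivity), ← ENNReal.ofReal_mul (by positivity),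
    ENNReal.ofReal_le_ofReal_iff
      (mul_nonneg (by positivity) (integral_nonneg fun _ => by positivity)),
    div_mul_eq_mul_div] at h
  exact h
end
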